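/- For every integer d ≥ 1 and every real t > 0 there exists a constant c > 0 such that for every ε > 0 there exists N with the following property: for every integer n ≥ N and all measurable sets A, B ⊆ ℝ^d of finite positive Lebesgue measure with |A| = t·|B|, if b_1, …, b_n are chosen independently and uniformly at random from B, then E(|⋃_{i=1}^n (A + b_i)|) ≥ (|A|^{1/d} + |B|^{1/d})^d · (1 − (c + ε)·n^{−2/(d+1)}). -/

import Mathlib

open MeasureTheory

/-- The expected volume of `⋃ i, (A i + b i)` when each `b i` is chosen independently
and uniformly at random from `B i`. -/
noncomputable def expUnion {d n : ℕ} (A B : Fin n → Set (EuclideanSpace ℝ (Fin d))) : ℝ :=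
  ((∏ i, volume (B i))⁻¹ *
    ∫⁻ b in Set.univ.pi B, volume (⋃ i, (· + b i) '' (A i))).toReal

section Helpers

open Set
open scoped ENNReal

/-- Lebesgue measure on a set of finite measure is the image of Lebesgue measure on an interval
under a monotone map. -/
theorem exists_monotone_map_restrict {a : Set ℝ} (hfin : volume a ≠ ∞) :
    ∃ u : ℝ → ℝ, Measurable u ∧ MonotoneOn u (Ioo 0 (volume a).toReal) ∧
      Measure.map u (volume.restrict (Ioo 0 (volume a).toReal)) = volume.restrict a := by
  classical
  set α := (volume a).toReal with hα
  have : IsFiniteMeasure (volume.restrict a) := ⟨by simpa using hfin.lt_top⟩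
  set μ : Measure ℝ := volume.restrict a with hμ
  let G : ℝ → ℝ := fun t => (μ (Iic t)).toReal
  have hGmono : Monotone G := fun s t h =>
    ENNReal.toReal_mono (measure_ne_top _ _) (measure_mono (Iic_subset_Iic.2 h))
  have hGle : ∀ s t, s ≤ t → G t ≤ G s + (t - s) := by
    intro s t h
    have h1 : μ (Iic t) ≤ μ (Iic s) + ENNReal.ofReal (t - s) := by
      rw [← Iic_union_Ioc_eq_Iic h]
      refine (measure_union_le _ _).trans ?_
      gcongr
      exact (Measure.restrict_apply_le _ _).trans (by simp)
    have := ENNReal.toReal_mono (by simp [measure_ne_top]) h1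
    rwa [ENNReal.toReal_add (measure_ne_top _ _) (by simp),
      ENNReal.toReal_ofReal (by linarith)] at this
  have huniv : μ univ = volume a := by simp [hμ]
  have hbot : ∀ c, 0 < c → ∃ t, G t < c := by
    intro c hc
    have h1 : Filter.Tendsto (fun t => (μ (Ici t)).toReal) Filter.atBot (nhds α) := by
      have := tendsto_measure_Ici_atBot μ
      rw [huniv] at this
      exact (ENNReal.tendsto_toReal hfin).comp this
    obtain ⟨t, ht⟩ := (h1.eventually (lt_mem_nhds (sub_lt_self α hc))).exists
    refine ⟨t - 1, ?_⟩
    have h2 : G (t - 1) + (μ (Ici t)).toReal ≤ α := by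
      rw [← ENNReal.toReal_add (measure_ne_top _ _) (measure_ne_top _ _), hα, ← huniv]
      refine ENNReal.toReal_mono (measure_ne_top _ _) ?_
      rw [← measure_union _ measurableSet_Ici]
      · exact measure_mono (subset_univ _)
      · rw [Set.disjoint_left]
        intro x hx hx'
        have h3 : x ≤ t - 1 := hx
        have h4 : t ≤ x := hx'
        linarith
    linarith
  have htop : Filter.Tendsto G Filter.atTop (nhds α) := by
    have := tendsto_measure_Iic_atTop μ
    rw [huniv] at this
    exact (ENNReal.tendsto_toReal hfin).comp this
  have hne : ∀ c ∈ Ioo 0 α, {t | c ≤ G t}.Nonempty := by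
    intro c hc
    obtain ⟨t, ht⟩ := (htop.eventually (lt_mem_nhds hc.2)).exists
    exact ⟨t, le_of_lt ht⟩
  have hbdd : ∀ c ∈ Ioo 0 α, BddBelow {t | c ≤ G t} := by
    intro c hc
    obtain ⟨t, ht⟩ := hbot c hc.1
    refine ⟨t, fun s hs => ?_⟩
    by_contra! h
    exact absurd (hGmono h.le) (not_le.2 (lt_of_lt_of_le ht hs))
  let v : ℝ → ℝ := fun c => sInf {t | c ≤ G t}
  have hv : ∀ c ∈ Ioo 0 α, ∀ t, v c ≤ t ↔ c ≤ G t := by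
    intro c hc t
    refine ⟨fun h => ?_, fun h => csInf_le (hbdd c hc) h⟩
    refine le_of_forall_pos_le_add fun ε hε => ?_
    obtain ⟨s, hs, hs'⟩ := exists_lt_of_csInf_lt (hne c hc)
      (lt_of_le_of_lt h (lt_add_of_pos_right t hε))
    have h1 : c ≤ G (t + ε) := le_trans hs (hGmono hs'.le)
    linarith [hGle t (t + ε) (by linarith)]
  have hvm : MonotoneOn v (Ioo 0 α) := by
    intro c hc c' hc' h
    rw [hv c hc]
    exact h.trans ((hv c' hc' _).1 le_rfl)
  let u : ℝ → ℝ := (Ioo 0 α).indicator v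
  have hu : ∀ c ∈ Ioo 0 α, u c = v c := fun c hc => indicator_of_mem hc _
  have hum : Measurable u := by
    have : Measurable ((Ioo 0 α).domRestrict v) :=
      Monotone.measurable (fun x y h => hvm x.2 y.2 h)
    refine measurable_of_restrict_of_restrict_compl (s := Ioo 0 α) measurableSet_Ioo ?_ ?_
    · convert this using 1
      ext x
      exact hu x x.2
    · have : (Ioo 0 α)ᶜ.domRestrict u = fun _ => 0 := by
        ext x
        exact indicator_of_notMem x.2 _
      rw [this]; exact measurable_const
  refine ⟨u, hum, fun c hc c' hc' h => by rw [hu c hc, hu c' hc']; exact hvm hc hc' h, ?_⟩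
  symm
  refine Measure.ext_of_Iic _ _ fun t => ?_
  rw [Measure.map_apply hum measurableSet_Iic, Measure.restrict_apply (hum measurableSet_Iic)]
  have hle : G t ≤ α := ENNReal.toReal_mono hfin (huniv ▸ measure_mono (subset_univ _))
  have h1 : u ⁻¹' Iic t ∩ Ioo 0 α = Ioc 0 (G t) ∩ Ioo 0 α := by
    ext c
    constructor
    · rintro ⟨h, hc⟩
      exact ⟨⟨hc.1, (hv c hc t).1 (by rw [← hu c hc]; exact h)⟩, hc⟩
    · rintro ⟨h, hc⟩
      refine ⟨?_, hc⟩
      change u c ≤ t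
      rw [hu c hc]
      exact (hv c hc t).2 h.2
  have h2 : volume (Ioc 0 (G t) ∩ Ioo 0 α) = ENNReal.ofReal (G t) := by
    apply le_antisymm
    · exact (measure_mono inter_subset_left).trans (by simp)
    · have : Ioo 0 (G t) ⊆ Ioc 0 (G t) ∩ Ioo 0 α :=
        fun x hx => ⟨⟨hx.1, hx.2.le⟩, ⟨hx.1, hx.2.trans_le hle⟩⟩
      simpa using measure_mono (μ := volume) this
  rw [h1, h2]
  exact (ENNReal.ofReal_toReal (measure_ne_top _ _)).symm

theorem exists_antitone_map_restrict {a : Set ℝ} (ha : MeasurableSet a) (hfin : volume a ≠ ∞) :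
    ∃ u : ℝ → ℝ, Measurable u ∧ AntitoneOn u (Ioo 0 (volume a).toReal) ∧
      Measure.map u (volume.restrict (Ioo 0 (volume a).toReal)) = volume.restrict a := by
  have hneg : volume (Neg.neg ⁻¹' a) = volume a := Measure.measure_preimage_neg _ _
  obtain ⟨u, hu, hmono, hmap⟩ := exists_monotone_map_restrict (a := Neg.neg ⁻¹' a)
    (by rwa [hneg])
  rw [hneg] at hmono hmap
  refine ⟨fun c => -u c, hu.neg, fun x hx y hy h => neg_le_neg (hmono hx hy h), ?_⟩
  have : (fun c => -u c) = Neg.neg ∘ u := rfl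
  rw [this, ← Measure.map_map measurable_neg hu, hmap]
  have := (Measure.measurePreserving_neg (volume : Measure ℝ)).restrict_preimage ha
  exact this.map_eq

/-- The measure of the set of pairs in `A × B` whose sum lies in `C`. -/
noncomputable def additivePairs {G : Type*} [Add G] [MeasureSpace G] (A B C : Set G) : ℝ≥0∞ :=
  volume {p : G × G | p.1 ∈ A ∧ p.2 ∈ B ∧ p.1 + p.2 ∈ C}

theorem additivePairs_mono {G : Type*} [Add G] [MeasureSpace G] {A B C A' B' C' : Set G}
    (hA : A ⊆ A') (hB : B ⊆ B') (hC : C ⊆ C') :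
    additivePairs A B C ≤ additivePairs A' B' C' :=
  measure_mono fun _ hp => ⟨hA hp.1, hB hp.2.1, hC hp.2.2⟩

theorem measurableSet_additivePairs {G : Type*} [Add G] [MeasurableSpace G] [MeasurableAdd₂ G]
    {A B C : Set G} (hA : MeasurableSet A) (hB : MeasurableSet B) (hC : MeasurableSet C) :
    MeasurableSet {p : G × G | p.1 ∈ A ∧ p.2 ∈ B ∧ p.1 + p.2 ∈ C} :=
  (measurable_fst hA).inter ((measurable_snd hB).inter (measurable_add hC))

theorem additivePairs_le_mul {G : Type*} [Add G] [MeasureSpace G] [SFinite (volume : Measure G)]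
    (A B C : Set G) : additivePairs A B C ≤ volume A * volume B := by
  have : volume A * volume B = volume (A ×ˢ B) := (Measure.prod_prod A B).symm
  rw [this]
  exact measure_mono fun p hp => ⟨hp.1, hp.2.1⟩

theorem additivePairs_eq_lintegral {G : Type*} [Add G] [MeasureSpace G] [MeasurableAdd₂ G]
    [SFinite (volume : Measure G)] {A B C : Set G} (hA : MeasurableSet A)
    (hB : MeasurableSet B) (hC : MeasurableSet C) : additivePairs A B C =
      ∫⁻ x, ∫⁻ y, A.indicator 1 x * B.indicator 1 y * C.indicator (1 : G → ℝ≥0∞) (x + y) := by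
  have hm := measurableSet_additivePairs hA hB hC
  rw [additivePairs, ← lintegral_indicator_one hm, Measure.volume_eq_prod,
    lintegral_prod _ (measurable_one.indicator hm).aemeasurable]
  refine lintegral_congr fun x => lintegral_congr fun y => ?_
  by_cases h1 : x ∈ A <;> by_cases h2 : y ∈ B <;> by_cases h3 : x + y ∈ C <;>
    simp [h1, h2, h3, indicator]

theorem additivePairs_comm {G : Type*} [AddCommSemigroup G] [MeasureSpace G]
    [SFinite (volume : Measure G)] (A B C : Set G) :
    additivePairs A B C = additivePairs B A C := by
  have h : MeasurePreserving (Prod.swap : G × G → G × G) volume volume :=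
    Measure.measurePreserving_swap
  have h2 := h.measure_preimage_equiv (f := MeasurableEquiv.prodComm)
    {p : G × G | p.1 ∈ B ∧ p.2 ∈ A ∧ p.1 + p.2 ∈ C}
  rw [additivePairs, additivePairs]
  refine Eq.trans ?_ h2
  congr 1
  ext p
  change (p.1 ∈ A ∧ p.2 ∈ B ∧ p.1 + p.2 ∈ C) ↔ (p.2 ∈ B ∧ p.1 ∈ A ∧ p.2 + p.1 ∈ C)
  rw [add_comm p.2, and_left_comm]

theorem volume_fst_mem_add_mem {G : Type*} [AddGroup G] [MeasureSpace G] [MeasurableAdd₂ G]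
    [MeasurableNeg G] [SFinite (volume : Measure G)] [(volume : Measure G).IsAddLeftInvariant]
    (A C : Set G) : volume {p : G × G | p.1 ∈ A ∧ p.1 + p.2 ∈ C} = volume A * volume C := by
  have h := measurePreserving_prod_add (volume : Measure G) (volume : Measure G)
  have h2 := h.measure_preimage_equiv (f := MeasurableEquiv.shearAddRight G) (A ×ˢ C)
  rw [Measure.prod_prod] at h2
  exact h2

theorem additivePairs_le_mul' {G : Type*} [AddGroup G] [MeasureSpace G] [MeasurableAdd₂ G]
    [MeasurableNeg G] [SFinite (volume : Measure G)] [(volume : Measure G).IsAddLeftInvariant]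
    (A B C : Set G) : additivePairs A B C ≤ volume A * volume C :=
  volume_fst_mem_add_mem A C ▸ measure_mono fun _ hp => ⟨hp.1, hp.2.2⟩

theorem lintegral_Ioi_ofReal_sub {θ : ℝ} (hθ : 0 ≤ θ) :
    ∫⁻ s in Ioi 0, ENNReal.ofReal (θ - s) = ENNReal.ofReal (θ ^ 2 / 2) := by
  have h1 : ∫⁻ s in Ioi 0, ENNReal.ofReal (θ - s) = ∫⁻ s in Ioc 0 θ, ENNReal.ofReal (θ - s) := by
    rw [← Ioc_union_Ioi_eq_Ioi hθ, lintegral_union measurableSet_Ioi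
      (Ioc_disjoint_Ioi le_rfl)]
    have : ∫⁻ s in Ioi θ, ENNReal.ofReal (θ - s) = 0 := by
      rw [setLIntegral_congr_fun (g := fun _ => 0) measurableSet_Ioi]
      · simp
      · intro s hs
        exact ENNReal.ofReal_of_nonpos (sub_nonpos.2 (le_of_lt hs))
    rw [this, add_zero]
  rw [h1, ← ofReal_integral_eq_lintegral_ofReal]
  · rw [← intervalIntegral.integral_of_le hθ]
    congr 1
    rw [intervalIntegral.integral_sub (by simp) (by simp)]
    simp
    ring
  · exact (continuous_const.sub continuous_id).integrableOn_Ioc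
  · refine (ae_restrict_iff' measurableSet_Ioc).2 (ae_of_all _ fun s hs => ?_)
    exact sub_nonneg.2 hs.2

theorem volume_triangle {θ : ℝ} (hθ : 0 ≤ θ) :
    volume {p : ℝ × ℝ | 0 < p.1 ∧ 0 < p.2 ∧ p.1 + p.2 ≤ θ} = ENNReal.ofReal (θ ^ 2 / 2) := by
  have hm : MeasurableSet {p : ℝ × ℝ | 0 < p.1 ∧ 0 < p.2 ∧ p.1 + p.2 ≤ θ} := by
    measurability
  rw [Measure.volume_eq_prod, Measure.prod_apply hm, ← lintegral_Ioi_ofReal_sub hθ,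
    ← lintegral_indicator measurableSet_Ioi]
  congr 1
  ext s
  by_cases hs : 0 < s
  · have : Prod.mk s ⁻¹' {p : ℝ × ℝ | 0 < p.1 ∧ 0 < p.2 ∧ p.1 + p.2 ≤ θ} = Ioc 0 (θ - s) := by
      ext c
      simp only [mem_preimage, mem_ofPred_eq, mem_Ioc]
      constructor
      · rintro ⟨_, h1, h2⟩; exact ⟨h1, by linarith⟩
      · rintro ⟨h1, h2⟩; exact ⟨hs, h1, by linarith⟩
    rw [this, indicator_of_mem (by exact hs)]
    simp
  · have : Prod.mk s ⁻¹' {p : ℝ × ℝ | 0 < p.1 ∧ 0 < p.2 ∧ p.1 + p.2 ≤ θ} = ∅ := by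
      ext c
      simp [hs]
    rw [this, indicator_of_notMem (by exact hs)]
    simp

/-- The open interval centred at the origin of length `m`. -/
def centredInterval (m : ℝ≥0∞) : Set ℝ := {x | ENNReal.ofReal (2 * |x|) < m}

theorem mem_centredInterval_ofReal {x α : ℝ} :
    x ∈ centredInterval (ENNReal.ofReal α) ↔ 2 * |x| < α := by
  rw [centredInterval, mem_ofPred_eq]
  constructor
  · intro h
    by_contra! h2
    exact absurd (ENNReal.ofReal_le_ofReal h2) (not_le.2 h)
  · intro h
    exact (ENNReal.ofReal_lt_ofReal_iff (lt_of_le_of_lt (by positivity) h)).2 h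

theorem centredInterval_ofReal (α : ℝ) :
    centredInterval (ENNReal.ofReal α) = Ioo (-(α / 2)) (α / 2) := by
  ext x
  rw [mem_centredInterval_ofReal, mem_Ioo, ← abs_lt]
  constructor <;> intro h <;> linarith

theorem volume_centredInterval_ofReal (α : ℝ) :
    volume (centredInterval (ENNReal.ofReal α)) = ENNReal.ofReal α := by
  rw [centredInterval_ofReal, Real.volume_Ioo]
  congr 1
  ring

theorem le_additivePairs_centredInterval {α β γ θ : ℝ} (hα : 0 ≤ α)
    (hθ : 0 ≤ θ) (h : α + β - γ = 2 * θ) :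
    ENNReal.ofReal (α * β) ≤ additivePairs (centredInterval (ENNReal.ofReal α))
      (centredInterval (ENNReal.ofReal β)) (centredInterval (ENNReal.ofReal γ)) +
      ENNReal.ofReal (θ ^ 2) := by
  set T := {p : ℝ × ℝ | 0 < p.1 ∧ 0 < p.2 ∧ p.1 + p.2 ≤ θ} with hT
  set z : ℝ × ℝ := (α / 2, β / 2) with hz
  have h1 : volume ((fun p => p + z) ⁻¹' T) = volume T := measure_preimage_add_right _ _ _
  have h2 : volume ((fun p => -p + z) ⁻¹' T) = volume T := by
    have : (fun p => -p + z) ⁻¹' T = Neg.neg ⁻¹' ((fun p => p + z) ⁻¹' T) := rfl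
    rw [this, Measure.measure_preimage_neg, h1]
  have h3 : ENNReal.ofReal (θ ^ 2) = volume ((fun p => p + z) ⁻¹' T) +
      volume ((fun p => -p + z) ⁻¹' T) := by
    rw [h1, h2, volume_triangle hθ, ← ENNReal.ofReal_add (by positivity) (by positivity)]
    congr 1
    ring
  have h4 : ENNReal.ofReal (α * β) = volume (centredInterval (ENNReal.ofReal α) ×ˢ
      centredInterval (ENNReal.ofReal β)) := by
    rw [Measure.volume_eq_prod, Measure.prod_prod, volume_centredInterval_ofReal,
      volume_centredInterval_ofReal, ENNReal.ofReal_mul hα]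
  rw [h3, h4, additivePairs]
  refine (measure_mono ?_).trans ((measure_union_le _ _).trans
    (add_le_add_right (measure_union_le _ _) _))
  rintro ⟨x, y⟩ ⟨hx, hy⟩
  simp only [centredInterval_ofReal, mem_Ioo] at hx hy
  simp only [centredInterval_ofReal, mem_Ioo, mem_union, mem_ofPred_eq, mem_preimage, hT, hz,
    Prod.fst_add, Prod.snd_add, Prod.fst_neg, Prod.snd_neg]
  by_cases c1 : x + y ≤ -(γ / 2)
  · right; left
    refine ⟨?_, ?_, ?_⟩ <;> linarith
  · by_cases c2 : γ / 2 ≤ x + y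
    · right; right
      refine ⟨?_, ?_, ?_⟩ <;> linarith
    · left
      push Not at c1 c2
      exact ⟨hx, hy, c1, c2⟩

theorem additivePairs_eq_volume_of_map {a b e : Set ℝ} {α β : ℝ} {u v : ℝ → ℝ}
    (he : MeasurableSet e) (hu : Measurable u) (hv : Measurable v)
    (hua : Measure.map u (volume.restrict (Ioo 0 α)) = volume.restrict a)
    (hvb : Measure.map v (volume.restrict (Ioo 0 β)) = volume.restrict b) :
    additivePairs a b e =
      volume {p : ℝ × ℝ | p.1 ∈ Ioo 0 α ∧ p.2 ∈ Ioo 0 β ∧ u p.1 + v p.2 ∈ e} := by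
  have hm : MeasurableSet {p : ℝ × ℝ | p.1 + p.2 ∈ e} := measurable_add he
  have h1 : additivePairs a b e =
      ((volume.restrict a).prod (volume.restrict b)) {p : ℝ × ℝ | p.1 + p.2 ∈ e} := by
    rw [Measure.prod_restrict, Measure.restrict_apply hm, additivePairs, Measure.volume_eq_prod]
    congr 1
    ext p
    simp only [mem_ofPred_eq, mem_inter_iff, mem_prod]
    tauto
  rw [h1, ← hua, ← hvb, Measure.map_prod_map _ _ hu hv, Measure.map_apply (by fun_prop) hm,
    Measure.prod_restrict, Measure.restrict_apply (by
      exact (show Measurable (Prod.map u v) by fun_prop) hm), Measure.volume_eq_prod]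
  congr 1
  ext p
  simp only [mem_ofPred_eq, mem_inter_iff, mem_prod, mem_preimage, Prod.map]
  tauto

theorem volume_Ioo_inter_preimage_le {a e : Set ℝ} {α r z : ℝ} {u : ℝ → ℝ} {K : Set ℝ}
    (he : MeasurableSet e) (hK : MeasurableSet K) (hu : Measurable u)
    (hua : Measure.map u (volume.restrict (Ioo 0 α)) = volume.restrict a) (hr : 0 < r)
    (h : ∀ s ∈ Ioo r α, u s + z ∈ K) :
    volume {s | s ∈ Ioo r α ∧ u s + z ∈ e} ≤ volume (e ∩ K) := by
  have hm : MeasurableSet ((fun x => x + z) ⁻¹' (e ∩ K)) := (measurable_add_const z) (he.inter hK)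
  calc volume {s | s ∈ Ioo r α ∧ u s + z ∈ e}
      ≤ volume (u ⁻¹' ((fun x => x + z) ⁻¹' (e ∩ K)) ∩ Ioo 0 α) :=
        measure_mono fun s hs => ⟨⟨hs.2, h s hs.1⟩, ⟨hr.trans hs.1.1, hs.1.2⟩⟩
    _ = (volume.restrict a) ((fun x => x + z) ⁻¹' (e ∩ K)) := by
        rw [← hua, Measure.map_apply hu hm, Measure.restrict_apply (hu hm)]
    _ ≤ volume ((fun x => x + z) ⁻¹' (e ∩ K)) := Measure.restrict_apply_le _ _
    _ = volume (e ∩ K) := measure_preimage_add_right _ _ _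

theorem additivePairs_add_sq_le {a b e : Set ℝ} {α β γ θ : ℝ}
    (ha : MeasurableSet a) (he : MeasurableSet e)
    (hα : volume a = ENNReal.ofReal α) (hβ : volume b = ENNReal.ofReal β)
    (hγ : volume e = ENNReal.ofReal γ) (hα0 : 0 ≤ α) (hβ0 : 0 ≤ β) (hγ0 : 0 ≤ γ)
    (hθ : 0 ≤ θ) (hθα : θ ≤ α) (hθβ : θ ≤ β) (h : α + β - γ = 2 * θ) :
    additivePairs a b e + ENNReal.ofReal (θ ^ 2) ≤ ENNReal.ofReal (α * β) := by
  obtain ⟨u, hum, hu, hua⟩ := exists_antitone_map_restrict ha (by simp [hα])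
  obtain ⟨v, hvm, hv, hvb⟩ := exists_monotone_map_restrict (a := b) (by simp [hβ])
  rw [hα, ENNReal.toReal_ofReal hα0] at hu hua
  rw [hβ, ENNReal.toReal_ofReal hβ0] at hv hvb
  rw [additivePairs_eq_volume_of_map he hum hvm hua hvb]
  set T := {p : ℝ × ℝ | p.1 ∈ Ioo 0 α ∧ p.2 ∈ Ioo 0 β ∧ u p.1 + v p.2 ∈ e}
  set N₁ := {p : ℝ × ℝ | p.2 ∈ Ioo 0 θ ∧ p.1 ∈ Ioo p.2 α ∧ u p.1 + v p.2 ∉ e}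
  set N₂ := {p : ℝ × ℝ | p.1 ∈ Ioo 0 θ ∧ p.2 ∈ Ioo p.1 β ∧ u p.1 + v p.2 ∉ e}
  have hadd : Measurable fun p : ℝ × ℝ => u p.1 + v p.2 := by fun_prop
  have hN₁ : MeasurableSet N₁ := by
    refine (measurable_snd measurableSet_Ioo).inter (MeasurableSet.inter ?_ (hadd he).compl)
    exact (measurableSet_lt measurable_snd measurable_fst).inter
      (measurableSet_lt measurable_fst measurable_const)
  have hN₂ : MeasurableSet N₂ := by
    refine (measurable_fst measurableSet_Ioo).inter (MeasurableSet.inter ?_ (hadd he).compl)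
    exact (measurableSet_lt measurable_fst measurable_snd).inter
      (measurableSet_lt measurable_snd measurable_const)
  have hrect : ENNReal.ofReal (α * β) = volume (Ioo 0 α ×ˢ Ioo 0 β) := by
    rw [Measure.volume_eq_prod, Measure.prod_prod, ENNReal.ofReal_mul hα0]
    simp
  have hsum : volume T + (volume N₁ + volume N₂) ≤ ENNReal.ofReal (α * β) := by
    rw [hrect, ← measure_union _ hN₂, ← measure_union _ (hN₁.union hN₂)]
    · refine measure_mono ?_
      rintro ⟨s, c⟩ (h1 | h1 | h1)
      · exact ⟨h1.1, h1.2.1⟩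
      · obtain ⟨⟨h1, h2⟩, ⟨h3, h4⟩, -⟩ := h1
        exact ⟨⟨h1.trans h3, h4⟩, ⟨h1, h2.trans_le hθβ⟩⟩
      · obtain ⟨⟨h1, h2⟩, ⟨h3, h4⟩, -⟩ := h1
        exact ⟨⟨h1, h2.trans_le hθα⟩, ⟨h1.trans h3, h4⟩⟩
    · rw [Set.disjoint_left]
      rintro p h1 (h2 | h2)
      · exact h2.2.2 h1.2.2
      · exact h2.2.2 h1.2.2
    · rw [Set.disjoint_left]
      rintro p h1 h2
      exact absurd h1.2.1.1 (not_lt.2 h2.2.1.1.le)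
  refine le_trans (add_le_add_right ?_ _) hsum
  let f₁ : ℝ → ℝ≥0∞ := fun r => volume {s | s ∈ Ioo r α ∧ u s + v r ∉ e}
  let f₂ : ℝ → ℝ≥0∞ := fun r => volume {c | c ∈ Ioo r β ∧ u r + v c ∉ e}
  have hf₁ : Measurable ((Ioo 0 θ).indicator f₁) ∧
      volume N₁ = ∫⁻ r in Ioo 0 θ, f₁ r := by
    have h1 : (Ioo 0 θ).indicator f₁ = fun r => volume ((fun s => (s, r)) ⁻¹' N₁) := by
      ext r
      by_cases hr : r ∈ Ioo 0 θ
      · rw [indicator_of_mem hr]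
        refine congrArg volume (Set.ext fun s => ?_)
        exact ⟨fun h => ⟨hr, h⟩, fun h => h.2⟩
      · rw [indicator_of_notMem hr, eq_comm]
        convert measure_empty (μ := (volume : Measure ℝ))
        ext s
        exact ⟨fun h => hr h.1, fun h => h.elim⟩
    rw [← lintegral_indicator measurableSet_Ioo, h1, Measure.volume_eq_prod,
      Measure.prod_apply_symm hN₁]
    exact ⟨measurable_measure_prodMk_right hN₁, rfl⟩
  have hf₂ : volume N₂ = ∫⁻ r in Ioo 0 θ, f₂ r := by
    have h1 : (Ioo 0 θ).indicator f₂ = fun r => volume (Prod.mk r ⁻¹' N₂) := by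
      ext r
      by_cases hr : r ∈ Ioo 0 θ
      · rw [indicator_of_mem hr]
        refine congrArg volume (Set.ext fun s => ?_)
        exact ⟨fun h => ⟨hr, h⟩, fun h => h.2⟩
      · rw [indicator_of_notMem hr, eq_comm]
        convert measure_empty (μ := (volume : Measure ℝ))
        ext s
        exact ⟨fun h => hr h.1, fun h => h.elim⟩
    rw [← lintegral_indicator measurableSet_Ioo, h1, Measure.volume_eq_prod,
      Measure.prod_apply hN₂]
  have hmain : ∀ r ∈ Ioo 0 θ, ENNReal.ofReal (2 * (θ - r)) ≤ f₁ r + f₂ r := by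
    intro r hr
    have hrα : r ∈ Ioo 0 α := ⟨hr.1, hr.2.trans_le hθα⟩
    have hrβ : r ∈ Ioo 0 β := ⟨hr.1, hr.2.trans_le hθβ⟩
    have e1 : volume {s | s ∈ Ioo r α ∧ u s + v r ∈ e} ≤ volume (e ∩ Iic (u r + v r)) := by
      refine volume_Ioo_inter_preimage_le he measurableSet_Iic hum hua hr.1 fun s hs => ?_
      have := hu hrα ⟨hr.1.trans hs.1, hs.2⟩ hs.1.le
      simpa using this
    have e2 : volume {c | c ∈ Ioo r β ∧ u r + v c ∈ e} ≤ volume (e ∩ Ici (u r + v r)) := by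
      simp_rw [add_comm (u r)]
      refine volume_Ioo_inter_preimage_le he measurableSet_Ici hvm hvb hr.1 fun s hs => ?_
      have := hv hrβ ⟨hr.1.trans hs.1, hs.2⟩ hs.1.le
      simpa using this
    have e3 : volume (e ∩ Iic (u r + v r)) + volume (e ∩ Ici (u r + v r)) ≤
        ENNReal.ofReal γ := by
      rw [← hγ, ← measure_inter_add_sdiff e (measurableSet_Iic (a := u r + v r))]
      refine add_le_add le_rfl ?_
      rw [sdiff_eq, compl_Iic]
      refine (measure_mono_ae ?_)
      filter_upwards [(Ioi_ae_eq_Ici (μ := (volume : Measure ℝ)) (a := u r + v r)).mem_iff]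
        with x hx
      rintro ⟨h1, h2⟩
      exact ⟨h1, hx.2 h2⟩
    have e4 : ENNReal.ofReal (α - r) ≤ volume {s | s ∈ Ioo r α ∧ u s + v r ∈ e} + f₁ r := by
      rw [← Real.volume_Ioo]
      refine (measure_mono ?_).trans (measure_union_le _ _)
      intro s hs
      by_cases h : u s + v r ∈ e
      · exact Or.inl ⟨hs, h⟩
      · exact Or.inr ⟨hs, h⟩
    have e5 : ENNReal.ofReal (β - r) ≤ volume {c | c ∈ Ioo r β ∧ u r + v c ∈ e} + f₂ r := by
      rw [← Real.volume_Ioo]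
      refine (measure_mono ?_).trans (measure_union_le _ _)
      intro s hs
      by_cases h : u r + v s ∈ e
      · exact Or.inl ⟨hs, h⟩
      · exact Or.inr ⟨hs, h⟩
    have e6 : ENNReal.ofReal γ + ENNReal.ofReal (2 * (θ - r)) ≤
        ENNReal.ofReal γ + (f₁ r + f₂ r) := by
      rw [← ENNReal.ofReal_add hγ0 (by linarith [hr.2])]
      calc ENNReal.ofReal (γ + 2 * (θ - r))
          = ENNReal.ofReal (α - r) + ENNReal.ofReal (β - r) := by
            rw [← ENNReal.ofReal_add (by linarith [hrα.2]) (by linarith [hrβ.2])]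
            congr 1
            linarith
        _ ≤ _ := add_le_add e4 e5
        _ ≤ (volume (e ∩ Iic (u r + v r)) + f₁ r) + (volume (e ∩ Ici (u r + v r)) + f₂ r) := by
            gcongr
        _ = (volume (e ∩ Iic (u r + v r)) + volume (e ∩ Ici (u r + v r))) + (f₁ r + f₂ r) := by
            ring
        _ ≤ _ := by gcongr
    exact (ENNReal.add_le_add_iff_left ENNReal.ofReal_ne_top).1 e6
  calc ENNReal.ofReal (θ ^ 2) = 2 * ∫⁻ s in Ioi 0, ENNReal.ofReal (θ - s) := by
        rw [lintegral_Ioi_ofReal_sub hθ, ← ENNReal.ofReal_ofNat, ← ENNReal.ofReal_mul (by norm_num)]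
        congr 1
        ring
    _ = ∫⁻ s in Ioi 0, ENNReal.ofReal (2 * (θ - s)) := by
        rw [← lintegral_const_mul _ (by fun_prop)]
        congr 1
        ext s
        rw [ENNReal.ofReal_mul (by norm_num), ENNReal.ofReal_ofNat]
    _ ≤ ∫⁻ s in Ioo 0 θ, ENNReal.ofReal (2 * (θ - s)) := by
        rw [← lintegral_indicator measurableSet_Ioi, ← lintegral_indicator measurableSet_Ioo]
        refine lintegral_mono fun s => ?_
        by_cases h1 : s ∈ Ioo 0 θ
        · rw [indicator_of_mem h1]
          exact indicator_le_self _ _ _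
        · by_cases h2 : 0 < s
          · have : θ ≤ s := by
              by_contra! h3
              exact h1 ⟨h2, h3⟩
            rw [indicator_of_mem (by exact h2), ENNReal.ofReal_of_nonpos (by linarith)]
            exact zero_le
          · rw [indicator_of_notMem (by exact h2)]
            exact zero_le
    _ ≤ ∫⁻ s in Ioo 0 θ, f₁ s + f₂ s := setLIntegral_mono' measurableSet_Ioo hmain
    _ = volume N₁ + volume N₂ := by
        rw [hf₁.2, hf₂]
        refine lintegral_add_left' ?_ _
        exact (aemeasurable_indicator_iff measurableSet_Ioo).1 hf₁.1.aemeasurable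

/-- The Riesz rearrangement inequality for sets on the real line. -/
theorem additivePairs_le_centredInterval {a b e : Set ℝ}
    (ha : MeasurableSet a) (he : MeasurableSet e)
    (hfa : volume a ≠ ∞) (hfb : volume b ≠ ∞) (hfe : volume e ≠ ∞) :
    additivePairs a b e ≤ additivePairs (centredInterval (volume a)) (centredInterval (volume b))
      (centredInterval (volume e)) := by
  obtain ⟨α, hα0, hα⟩ : ∃ α : ℝ, 0 ≤ α ∧ volume a = ENNReal.ofReal α :=
    ⟨_, ENNReal.toReal_nonneg, (ENNReal.ofReal_toReal hfa).symm⟩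
  obtain ⟨β, hβ0, hβ⟩ : ∃ β : ℝ, 0 ≤ β ∧ volume b = ENNReal.ofReal β :=
    ⟨_, ENNReal.toReal_nonneg, (ENNReal.ofReal_toReal hfb).symm⟩
  obtain ⟨γ, hγ0, hγ⟩ : ∃ γ : ℝ, 0 ≤ γ ∧ volume e = ENNReal.ofReal γ :=
    ⟨_, ENNReal.toReal_nonneg, (ENNReal.ofReal_toReal hfe).symm⟩
  have hlong : ∀ {a b : Set ℝ} {α β : ℝ}, volume a = ENNReal.ofReal α →
      volume b = ENNReal.ofReal β → α + γ < β → additivePairs a b e ≤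
        additivePairs (centredInterval (volume a)) (centredInterval (volume b))
          (centredInterval (volume e)) := by
    intro a b α β hα hβ h
    refine (additivePairs_le_mul' a b e).trans ?_
    rw [hα, hβ, hγ, ← volume_centredInterval_ofReal α, ← volume_centredInterval_ofReal γ,
      ← volume_fst_mem_add_mem]
    simp only [volume_centredInterval_ofReal, additivePairs]
    refine measure_mono ?_
    rintro ⟨x, y⟩ ⟨h1, h2⟩
    refine ⟨h1, ?_, h2⟩
    simp only [centredInterval_ofReal, mem_Ioo] at h1 h2 ⊢
    constructor <;> linarith
  set θ := (α + β - γ) / 2 with hθdef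
  have hθ : α + β - γ = 2 * θ := by rw [hθdef]; ring
  rcases lt_or_ge θ 0 with h0 | h0
  · refine (additivePairs_le_mul a b e).trans ?_
    rw [hα, hβ, hγ, ← volume_centredInterval_ofReal α, ← volume_centredInterval_ofReal β,
      ← Measure.prod_prod]
    simp only [volume_centredInterval_ofReal, additivePairs]
    refine measure_mono ?_
    rintro ⟨x, y⟩ ⟨h1, h2⟩
    refine ⟨h1, h2, ?_⟩
    simp only [centredInterval_ofReal, mem_Ioo] at h1 h2 ⊢
    constructor <;> linarith
  rcases lt_or_ge α θ with h1 | h1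
  · exact hlong hα hβ (by linarith)
  rcases lt_or_ge β θ with h2 | h2
  · rw [additivePairs_comm, additivePairs_comm (centredInterval (volume a))]
    exact hlong hβ hα (by linarith)
  have key := (additivePairs_add_sq_le ha he hα hβ hγ hα0 hβ0 hγ0 h0 h1 h2 hθ).trans
    (le_additivePairs_centredInterval hα0 h0 hθ)
  rw [← hα, ← hβ, ← hγ] at key
  exact (ENNReal.add_le_add_iff_right ENNReal.ofReal_ne_top).1 key

theorem volume_centredInterval (m : ℝ≥0∞) : volume (centredInterval m) = m := by
  by_cases hm : m = ∞
  · rw [hm]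
    simp only [centredInterval, ENNReal.ofReal_lt_top]
    simp
  · rw [← ENNReal.ofReal_toReal hm, volume_centredInterval_ofReal]

theorem centredInterval_inter (m m' : ℝ≥0∞) :
    centredInterval m ∩ centredInterval m' = centredInterval (min m m') := by
  ext x
  simp [centredInterval]

/-- The slice of `A ⊆ ℝ × W` over `w`. -/
def lineSlice {W : Type*} (A : Set (ℝ × W)) (w : W) : Set ℝ := (fun t => (t, w)) ⁻¹' A

/-- The Steiner symmetrization of a subset of `ℝ × W` along the first coordinate. -/
def steiner {W : Type*} (A : Set (ℝ × W)) : Set (ℝ × W) :=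
  {p | p.1 ∈ centredInterval (volume (lineSlice A p.2))}

section steiner

variable {W : Type*}

theorem lineSlice_steiner (A : Set (ℝ × W)) (w : W) :
    lineSlice (steiner A) w = centredInterval (volume (lineSlice A w)) := rfl

theorem volume_lineSlice_steiner (A : Set (ℝ × W)) (w : W) :
    volume (lineSlice (steiner A) w) = volume (lineSlice A w) := by
  rw [lineSlice_steiner, volume_centredInterval]

theorem steiner_mono {A B : Set (ℝ × W)} (h : A ⊆ B) : steiner A ⊆ steiner B := fun _ hp =>
  lt_of_lt_of_le (show _ < _ from hp) (measure_mono (preimage_mono h))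

theorem measurableSet_lineSlice [MeasurableSpace W] {A : Set (ℝ × W)} (hA : MeasurableSet A)
    (w : W) : MeasurableSet (lineSlice A w) := measurable_prodMk_right hA

theorem measurableSet_steiner [MeasurableSpace W] {A : Set (ℝ × W)} (hA : MeasurableSet A) :
    MeasurableSet (steiner A) :=
  measurableSet_lt (f := fun p : ℝ × W => ENNReal.ofReal (2 * |p.1|)) (by fun_prop)
    ((measurable_measure_prodMk_right hA).comp measurable_snd)

theorem volume_eq_lintegral_lineSlice [MeasureSpace W] [SFinite (volume : Measure W)]
    {A : Set (ℝ × W)} (hA : MeasurableSet A) : volume A = ∫⁻ w, volume (lineSlice A w) := by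
  rw [Measure.volume_eq_prod, Measure.prod_apply_symm hA]
  rfl

theorem volume_steiner [MeasureSpace W] [SFinite (volume : Measure W)]
    {A : Set (ℝ × W)} (hA : MeasurableSet A) : volume (steiner A) = volume A := by
  simp_rw [volume_eq_lintegral_lineSlice hA,
    volume_eq_lintegral_lineSlice (measurableSet_steiner hA), volume_lineSlice_steiner]

theorem volume_inter_add_le_volume_steiner_inter [MeasureSpace W] [SFinite (volume : Measure W)]
    [AddZeroClass W] [MeasurableAdd W] {A K : Set (ℝ × W)} (hA : MeasurableSet A)
    (hK : MeasurableSet K)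
    (hKs : steiner K = K) (s : ℝ) :
    volume (A ∩ K) + volume ((A \ K) ∩ (fun p => p + (s, 0)) ⁻¹' (K \ A)) ≤
      volume (steiner A ∩ K) := by
  have hm : MeasurableSet ((A \ K) ∩ (fun p => p + (s, 0)) ⁻¹' (K \ A)) :=
    (hA.diff hK).inter ((show Measurable fun p : ℝ × W => p + (s, 0) from
      (measurable_fst.add_const s).prodMk (measurable_snd.add_const 0)) (hK.diff hA))
  rw [volume_eq_lintegral_lineSlice (hA.inter hK), volume_eq_lintegral_lineSlice hm,
    volume_eq_lintegral_lineSlice ((measurableSet_steiner hA).inter hK),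
    ← lintegral_add_left (show Measurable fun w => volume (lineSlice (A ∩ K) w) from
      measurable_measure_prodMk_right (hA.inter hK))]
  refine lintegral_mono fun w => ?_
  set a := lineSlice A w
  set k := lineSlice K w
  have ha : MeasurableSet a := measurableSet_lineSlice hA w
  have hk : MeasurableSet k := measurableSet_lineSlice hK w
  have h1 : lineSlice (steiner A ∩ K) w =
      centredInterval (min (volume a) (volume k)) := by
    rw [← centredInterval_inter, ← lineSlice_steiner K w, hKs]
    rfl
  have h2 : lineSlice (A ∩ K) w = a ∩ k := rfl
  have h3 : lineSlice ((A \ K) ∩ (fun p => p + (s, 0)) ⁻¹' (K \ A)) w =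
      (a \ k) ∩ (fun t => t + s) ⁻¹' (k \ a) := by
    ext t
    simp [lineSlice, a, k]
  rw [h1, h2, h3, volume_centredInterval, le_min_iff]
  constructor
  · rw [← measure_inter_add_sdiff a hk]
    gcongr
    exact inter_subset_left
  · rw [← measure_inter_add_sdiff k ha, inter_comm k a]
    refine add_le_add le_rfl ?_
    rw [← measure_preimage_add_right volume s (k \ a)]
    exact measure_mono inter_subset_right

theorem additivePairs_eq_lintegral_lineSlice [MeasureSpace W] [SFinite (volume : Measure W)]
    [Add W] [MeasurableAdd₂ (ℝ × W)] {A B C : Set (ℝ × W)} (hA : MeasurableSet A)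
    (hB : MeasurableSet B) (hC : MeasurableSet C) : additivePairs A B C =
      ∫⁻ w, ∫⁻ w', additivePairs (lineSlice A w) (lineSlice B w') (lineSlice C (w + w')) := by
  have hone : Measurable (1 : ℝ × W → ℝ≥0∞) := measurable_one
  have hmeas : Measurable fun q : (ℝ × W) × (ℝ × W) =>
      A.indicator 1 q.1 * B.indicator 1 q.2 * C.indicator (1 : ℝ × W → ℝ≥0∞) (q.1 + q.2) :=
    (((hone.indicator hA).comp measurable_fst).mul ((hone.indicator hB).comp measurable_snd)).mul
      ((hone.indicator hC).comp measurable_add)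
  rw [additivePairs_eq_lintegral hA hB hC]
  have h1 : Measurable fun x : ℝ × W => ∫⁻ y,
      A.indicator 1 x * B.indicator 1 y * C.indicator (1 : ℝ × W → ℝ≥0∞) (x + y) :=
    hmeas.lintegral_prod_right'
  refine (lintegral_prod_symm' (μ := (volume : Measure ℝ)) (ν := (volume : Measure W)) _
    h1).trans ?_
  refine lintegral_congr fun w => ?_
  have h2 : ∀ s : ℝ, ∫⁻ y, A.indicator 1 (s, w) * B.indicator 1 y *
        C.indicator (1 : ℝ × W → ℝ≥0∞) ((s, w) + y) =
      ∫⁻ w', ∫⁻ t, A.indicator 1 (s, w) * B.indicator 1 (t, w') *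
        C.indicator (1 : ℝ × W → ℝ≥0∞) ((s, w) + (t, w')) := fun s => by
    rw [Measure.volume_eq_prod]
    exact lintegral_prod_symm' _ (hmeas.comp measurable_prodMk_left)
  simp_rw [h2]
  rw [lintegral_lintegral_swap]
  · refine lintegral_congr fun w' => ?_
    rw [additivePairs_eq_lintegral (measurableSet_lineSlice hA _) (measurableSet_lineSlice hB _)
      (measurableSet_lineSlice hC _)]
    rfl
  · refine Measurable.aemeasurable ?_
    refine Measurable.lintegral_prod_right' (f := fun q : (ℝ × W) × ℝ =>
      A.indicator 1 (q.1.1, w) * B.indicator 1 (q.2, q.1.2) *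
        C.indicator (1 : ℝ × W → ℝ≥0∞) ((q.1.1, w) + (q.2, q.1.2))) ?_
    exact hmeas.comp (g := fun q : (ℝ × W) × (ℝ × W) => _)
      (f := fun q : (ℝ × W) × ℝ => ((q.1.1, w), (q.2, q.1.2)))
      (by fun_prop)

theorem additivePairs_le_steiner [MeasureSpace W] [SFinite (volume : Measure W)]
    [Add W] [MeasurableAdd₂ (ℝ × W)] {A B C : Set (ℝ × W)} (hA : MeasurableSet A)
    (hB : MeasurableSet B) (hC : MeasurableSet C) (hfA : ∀ w, volume (lineSlice A w) ≠ ∞)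
    (hfB : ∀ w, volume (lineSlice B w) ≠ ∞) (hfC : ∀ w, volume (lineSlice C w) ≠ ∞) :
    additivePairs A B C ≤ additivePairs (steiner A) (steiner B) (steiner C) := by
  rw [additivePairs_eq_lintegral_lineSlice hA hB hC,
    additivePairs_eq_lintegral_lineSlice (measurableSet_steiner hA) (measurableSet_steiner hB)
      (measurableSet_steiner hC)]
  exact lintegral_mono fun w => lintegral_mono fun w' =>
    additivePairs_le_centredInterval (measurableSet_lineSlice hA _)
      (measurableSet_lineSlice hC _) (hfA _) (hfB _) (hfC _)

end steiner

/-- The Euclidean ball of radius `r` in `ℝ × (Fin n → ℝ)`. -/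
def prodBall (n : ℕ) (r : ℝ) : Set (ℝ × (Fin n → ℝ)) :=
  {p | p.1 ^ 2 + ∑ i, p.2 i ^ 2 < r ^ 2}

theorem lineSlice_prodBall {n : ℕ} (r : ℝ) (w : Fin n → ℝ) : lineSlice (prodBall n r) w =
    centredInterval (ENNReal.ofReal (2 * √(r ^ 2 - ∑ i, w i ^ 2))) := by
  ext x
  rw [mem_centredInterval_ofReal]
  change x ^ 2 + ∑ i, w i ^ 2 < r ^ 2 ↔ _
  rw [← lt_sub_iff_add_lt, Real.sq_lt, ← abs_lt]
  constructor <;> intro h <;> linarith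

theorem steiner_prodBall (n : ℕ) (r : ℝ) : steiner (prodBall n r) = prodBall n r := by
  ext ⟨x, w⟩
  change x ∈ centredInterval (volume (lineSlice (prodBall n r) w)) ↔
    x ∈ lineSlice (prodBall n r) w
  rw [lineSlice_prodBall, volume_centredInterval]

theorem additivePairs_preimage {G H : Type*} [Add G] [Add H] [MeasureSpace G] [MeasureSpace H]
    [SFinite (volume : Measure G)] [SFinite (volume : Measure H)] (Φ : G ≃ᵐ H)
    (hΦ : MeasurePreserving Φ volume volume) (hadd : ∀ x y, Φ (x + y) = Φ x + Φ y)
    (A B C : Set H) :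
    additivePairs (Φ ⁻¹' A) (Φ ⁻¹' B) (Φ ⁻¹' C) = additivePairs A B C := by
  have h : MeasurePreserving (Φ.prodCongr Φ) (volume : Measure (G × G)) volume := hΦ.prod hΦ
  rw [additivePairs, additivePairs, ← h.measure_preimage_equiv]
  congr 1
  ext p
  change (_ ∧ _ ∧ Φ (p.1 + p.2) ∈ C) ↔ (_ ∧ _ ∧ Φ p.1 + Φ p.2 ∈ C)
  rw [hadd]
  rfl

theorem exists_measurableEquiv_prod {n : ℕ} (v : EuclideanSpace ℝ (Fin (n + 1))) :
    ∃ Φ : EuclideanSpace ℝ (Fin (n + 1)) ≃ᵐ ℝ × (Fin n → ℝ),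
      MeasurePreserving Φ volume volume ∧ (∀ x y, Φ (x + y) = Φ x + Φ y) ∧
      Φ v = (‖v‖, 0) ∧ ∀ r, 0 ≤ r → Φ ⁻¹' prodBall n r = Metric.ball 0 r := by
  set e : EuclideanSpace ℝ (Fin (n + 1)) := EuclideanSpace.single 0 ‖v‖ with he
  have hnorm : ‖v‖ = ‖e‖ := by simp [he]
  let g := (Submodule.span ℝ {v - e})ᗮ.reflection
  have hgv : g v = e := Submodule.reflection_sub hnorm
  let Ψ₁ := MeasurableEquiv.piFinSuccAbove (fun _ : Fin (n + 1) => ℝ) 0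
  let Ψ₀ := MeasurableEquiv.toLp 2 (Fin (n + 1) → ℝ)
  have hΦ : ∀ x, (g.toHomeomorph.toMeasurableEquiv.trans (Ψ₀.symm.trans Ψ₁)) x =
      (g x 0, fun i => g x i.succ) := fun x => rfl
  refine ⟨g.toHomeomorph.toMeasurableEquiv.trans (Ψ₀.symm.trans Ψ₁), ?_, ?_, ?_, ?_⟩
  · exact ((volume_preserving_piFinSuccAbove (fun _ : Fin (n + 1) => ℝ) 0).comp
      (PiLp.volume_preserving_ofLp _)).comp g.measurePreserving
  · intro x y
    rw [hΦ, hΦ, hΦ, map_add]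
    rfl
  · rw [hΦ, hgv]
    refine Prod.ext ?_ ?_
    · simp [he]
    · ext i
      simp [he]
  · intro r hr
    ext x
    rw [mem_preimage, hΦ, mem_ball_zero_iff, ← g.norm_map, ← sq_lt_sq₀ (norm_nonneg _) hr,
      EuclideanSpace.real_norm_sq_eq, Fin.sum_univ_succ]
    rfl

theorem exists_symmetrization {n : ℕ} (v : EuclideanSpace ℝ (Fin (n + 1))) :
    ∃ S : Set (EuclideanSpace ℝ (Fin (n + 1))) → Set (EuclideanSpace ℝ (Fin (n + 1))),
      (∀ A, MeasurableSet A → MeasurableSet (S A)) ∧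
      (∀ A, MeasurableSet A → volume (S A) = volume A) ∧
      (∀ A r, 0 ≤ r → A ⊆ Metric.ball 0 r → S A ⊆ Metric.ball 0 r) ∧
      (∀ A r, 0 ≤ r → MeasurableSet A → volume (A ∩ Metric.ball 0 r) +
        volume ((A \ Metric.ball 0 r) ∩ (fun p => p + v) ⁻¹' (Metric.ball 0 r \ A)) ≤
          volume (S A ∩ Metric.ball 0 r)) ∧
      (∀ A B C r, 0 ≤ r → MeasurableSet A → MeasurableSet B → MeasurableSet C →
        A ⊆ Metric.ball 0 r → B ⊆ Metric.ball 0 r → C ⊆ Metric.ball 0 r →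
        additivePairs A B C ≤ additivePairs (S A) (S B) (S C)) := by
  obtain ⟨Φ, hΦ, hadd, hv, hball⟩ := exists_measurableEquiv_prod v
  have hpre : ∀ A, Φ ⁻¹' (Φ.symm ⁻¹' A) = A := fun A => by
    rw [← preimage_comp]; simp
  have hball' : ∀ r, 0 ≤ r → Φ.symm ⁻¹' Metric.ball 0 r = prodBall n r := fun r hr => by
    rw [← hball r hr, ← preimage_comp]; simp
  have hmeas : ∀ A, MeasurableSet A → MeasurableSet (Φ.symm ⁻¹' A) :=
    fun A hA => Φ.symm.measurable hA
  have hfin : ∀ A r, 0 ≤ r → A ⊆ Metric.ball 0 r → ∀ w,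
      volume (lineSlice (Φ.symm ⁻¹' A) w) ≠ ∞ := by
    intro A r hr hA w
    refine ne_top_of_le_ne_top ?_ (measure_mono (preimage_mono
      ((preimage_mono hA).trans (hball' r hr).subset)))
    change volume (lineSlice (prodBall n r) w) ≠ ∞
    rw [lineSlice_prodBall, volume_centredInterval]
    exact ENNReal.ofReal_ne_top
  refine ⟨fun A => Φ ⁻¹' steiner (Φ.symm ⁻¹' A), ?_, ?_, ?_, ?_, ?_⟩
  · exact fun A hA => Φ.measurable (measurableSet_steiner (hmeas A hA))
  · intro A hA
    rw [hΦ.measure_preimage_equiv, volume_steiner (hmeas A hA), ← hΦ.measure_preimage_equiv, hpre]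
  · intro A r hr hA
    rw [← hball r hr, ← steiner_prodBall, ← hball' r hr]
    exact preimage_mono (steiner_mono (preimage_mono hA))
  · intro A r hr hA
    have h := volume_inter_add_le_volume_steiner_inter (hmeas A hA)
      (hmeas _ (Metric.isOpen_ball (x := 0) (ε := r)).measurableSet)
      (by rw [hball' r hr, steiner_prodBall]) ‖v‖
    rw [← hΦ.measure_preimage_equiv, ← hΦ.measure_preimage_equiv, ← hΦ.measure_preimage_equiv,
      preimage_inter, preimage_inter, preimage_inter, preimage_sdiff, hpre, hpre] at h
    convert h using 4
    ext x
    have : Φ.symm (Φ x + (‖v‖, 0)) = x + v := by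
      rw [← hv, ← hadd, Φ.symm_apply_apply]
    simp only [mem_preimage, mem_sdiff, this]
  · intro A B C r hr hA hB hC h1 h2 h3
    rw [additivePairs_preimage Φ hΦ hadd]
    calc additivePairs A B C
        = additivePairs (Φ.symm ⁻¹' A) (Φ.symm ⁻¹' B) (Φ.symm ⁻¹' C) := by
          rw [← additivePairs_preimage Φ hΦ hadd, hpre, hpre, hpre]
      _ ≤ _ := additivePairs_le_steiner (hmeas A hA) (hmeas B hB) (hmeas C hC) (hfin A r hr h1)
          (hfin B r hr h2) (hfin C r hr h3)

section ball

variable {E : Type*} [NormedAddCommGroup E] [NormedSpace ℝ E] [MeasureSpace E] [BorelSpace E]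
  [FiniteDimensional ℝ E] [(volume : Measure E).IsAddHaarMeasure]

theorem exists_volume_ball_eq [Nontrivial E] {m : ℝ≥0∞} (hm : m ≠ ∞) :
    ∃ r : ℝ, 0 ≤ r ∧ volume (Metric.ball (0 : E) r) = m := by
  set V := volume (Metric.ball (0 : E) 1) with hV
  have hV0 : V ≠ 0 := (Metric.measure_ball_pos _ _ one_pos).ne'
  have hVt : V ≠ ∞ := measure_ball_lt_top.ne
  have hd : Module.finrank ℝ E ≠ 0 := Module.finrank_pos.ne'
  refine ⟨(m / V).toReal ^ ((1 : ℝ) / Module.finrank ℝ E), by positivity, ?_⟩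
  rw [Measure.addHaar_ball _ _ (by positivity), one_div,
    Real.rpow_inv_natCast_pow (by positivity) hd,
    ENNReal.ofReal_toReal (ENNReal.div_ne_top hm hV0), ENNReal.div_mul_cancel hV0 hVt]

theorem le_of_volume_ball_le [Nontrivial E] {r s : ℝ} (hs : 0 ≤ s)
    (h : volume (Metric.ball (0 : E) r) ≤ volume (Metric.ball (0 : E) s)) : r ≤ s := by
  by_contra! hlt
  have hV0 : volume (Metric.ball (0 : E) 1) ≠ 0 := (Metric.measure_ball_pos _ _ one_pos).ne'
  rw [Measure.addHaar_ball _ _ hs, Measure.addHaar_ball _ _ (hs.trans hlt.le),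
    ENNReal.mul_le_mul_iff_left hV0 measure_ball_lt_top.ne,
    ENNReal.ofReal_le_ofReal_iff (by positivity)] at h
  exact absurd h (not_le.2 (pow_lt_pow_left₀ hlt hs Module.finrank_pos.ne'))

/-- Some translate of `Q` meets `P` in at least the average measure. -/
theorem exists_mul_le_volume_inter_translate {P Q : Set E} {R : ℝ} (hR : 0 < R)
    (hP : MeasurableSet P) (hQ : MeasurableSet Q) (hPR : P ⊆ Metric.ball 0 R)
    (hQR : Q ⊆ Metric.ball 0 R) : ∃ v : E, volume P * volume Q ≤
      volume (Metric.ball (0 : E) (2 * R)) * volume (P ∩ (fun p => p + v) ⁻¹' Q) := by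
  set f : E → ℝ≥0∞ := fun v => volume (P ∩ (fun p => p + v) ⁻¹' Q) with hf
  have hm : MeasurableSet {p : E × E | p.1 ∈ P ∧ p.1 + p.2 ∈ Q} :=
    (measurable_fst hP).inter (measurable_add hQ)
  have h1 : ∫⁻ v, f v = volume P * volume Q := by
    rw [← volume_fst_mem_add_mem, Measure.volume_eq_prod, Measure.prod_apply_symm hm]
    rfl
  have h2 : ∫⁻ v in Metric.ball (0 : E) (2 * R), f v = volume P * volume Q := by
    rw [← h1]
    refine setLIntegral_eq_of_support_subset ?_
    intro v hv
    obtain ⟨p, hp, hq⟩ := nonempty_of_measure_ne_zero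
      (show volume (P ∩ (fun p => p + v) ⁻¹' Q) ≠ 0 from hv)
    have h3 := mem_ball_zero_iff.1 (hPR hp)
    have h4 := mem_ball_zero_iff.1 (hQR hq)
    rw [mem_ball_zero_iff]
    have : v = (p + v) - p := by abel
    rw [this]
    exact (norm_sub_le _ _).trans_lt (by linarith)
  have hfin : volume P * volume Q ≠ ∞ :=
    ENNReal.mul_ne_top (measure_ne_top_of_subset hPR measure_ball_lt_top.ne)
      (measure_ne_top_of_subset hQR measure_ball_lt_top.ne)
  have hV0 : volume (Metric.ball (0 : E) (2 * R)) ≠ 0 :=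
    (Metric.measure_ball_pos _ _ (by linarith)).ne'
  obtain ⟨v, -, hv⟩ := exists_setLAverage_le hV0 Metric.isOpen_ball.measurableSet.nullMeasurableSet
    (h2 ▸ hfin)
  refine ⟨v, ?_⟩
  rw [setLAverage_eq, h2] at hv
  have h3 := (ENNReal.div_le_iff hV0 measure_ball_lt_top.ne).1 hv
  rwa [mul_comm (f v)] at h3

end ball

theorem additivePairs_le_add_diff {G : Type*} [AddGroup G] [MeasureSpace G] [MeasurableAdd₂ G]
    [MeasurableNeg G] [SFinite (volume : Measure G)] [(volume : Measure G).IsAddLeftInvariant]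
    (A B C A' B' C' : Set G) :
    additivePairs A B C ≤ additivePairs A' B' C' + volume (A \ A') * volume B +
      volume A * volume (B \ B') + volume A * volume (C \ C') := by
  refine le_trans ?_ (add_le_add (add_le_add (add_le_add le_rfl (additivePairs_le_mul (A \ A') B C))
    (additivePairs_le_mul A (B \ B') C)) (additivePairs_le_mul' A B (C \ C')))
  refine le_trans (measure_mono ?_) ((measure_union_le _ _).trans (add_le_add
    ((measure_union_le _ _).trans (add_le_add (measure_union_le _ _) le_rfl)) le_rfl))
  rintro p ⟨h1, h2, h3⟩
  simp only [mem_union, mem_ofPred_eq, mem_sdiff]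
  tauto

/-- The triples of sets of the same measures in a common ball which have at least as many additive
pairs as a given triple. -/
def IsRearrangement {E : Type*} [NormedAddCommGroup E] [MeasureSpace E] (R : ℝ)
    (A A' : Fin 3 → Set E) : Prop :=
  (∀ i, MeasurableSet (A' i) ∧ volume (A' i) = volume (A i) ∧ A' i ⊆ Metric.ball 0 R) ∧
    additivePairs (A 0) (A 1) (A 2) ≤ additivePairs (A' 0) (A' 1) (A' 2)

theorem IsRearrangement.exists_improvement {n : ℕ} {R : ℝ} (hR : 0 < R)
    {A A' : Fin 3 → Set (EuclideanSpace ℝ (Fin (n + 1)))} {a : Fin 3 → ℝ} (ha : ∀ i, 0 ≤ a i)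
    (haR : ∀ i, a i ≤ R)
    (hvol : ∀ i, volume (A i) = volume (Metric.ball (0 : EuclideanSpace ℝ (Fin (n + 1))) (a i)))
    (h : IsRearrangement R A A') (i : Fin 3) :
    ∃ A'', IsRearrangement R A A'' ∧
      ∑ j, (volume (A' j ∩ Metric.ball 0 (a j))).toReal +
        (volume (A' i \ Metric.ball 0 (a i))).toReal ^ 2 /
          (volume (Metric.ball (0 : EuclideanSpace ℝ (Fin (n + 1))) (2 * R))).toReal ≤
        ∑ j, (volume (A'' j ∩ Metric.ball 0 (a j))).toReal := by
  obtain ⟨hA, hI⟩ := h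
  have hK : ∀ j, MeasurableSet (Metric.ball (0 : EuclideanSpace ℝ (Fin (n + 1))) (a j)) :=
    fun j => Metric.isOpen_ball.measurableSet
  obtain ⟨v, hv⟩ := exists_mul_le_volume_inter_translate hR ((hA i).1.diff (hK i))
    ((hK i).diff (hA i).1) (sdiff_subset.trans (hA i).2.2)
    (sdiff_subset.trans (Metric.ball_subset_ball (haR i)))
  obtain ⟨S, hS1, hS2, hS3, hS4, hS5⟩ := exists_symmetrization v
  refine ⟨fun j => S (A' j), ⟨fun j => ⟨hS1 _ (hA j).1, (hS2 _ (hA j).1).trans (hA j).2.1,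
    hS3 _ _ hR.le (hA j).2.2⟩, hI.trans (hS5 _ _ _ R hR.le (hA 0).1 (hA 1).1 (hA 2).1
      (hA 0).2.2 (hA 1).2.2 (hA 2).2.2)⟩, ?_⟩
  have hfin : ∀ (X : Set (EuclideanSpace ℝ (Fin (n + 1)))) j,
      volume (X ∩ Metric.ball 0 (a j)) ≠ ∞ :=
    fun X j => measure_ne_top_of_subset inter_subset_right measure_ball_lt_top.ne
  have hmono : ∀ j, (volume (A' j ∩ Metric.ball 0 (a j))).toReal ≤
      (volume (S (A' j) ∩ Metric.ball 0 (a j))).toReal := fun j =>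
    ENNReal.toReal_mono (hfin _ _) (le_trans le_self_add (hS4 _ _ (ha j) (hA j).1))
  set V := volume (Metric.ball (0 : EuclideanSpace ℝ (Fin (n + 1))) (2 * R)) with hV
  have hV0 : V ≠ 0 := (Metric.measure_ball_pos _ _ (by linarith)).ne'
  have hVt : V ≠ ∞ := measure_ball_lt_top.ne
  set D := volume ((A' i \ Metric.ball 0 (a i)) ∩
    (fun p => p + v) ⁻¹' (Metric.ball 0 (a i) \ A' i)) with hD
  have hDt : D ≠ ∞ := measure_ne_top_of_subset
    (inter_subset_left.trans (sdiff_subset.trans (hA i).2.2)) measure_ball_lt_top.ne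
  have hAt : volume (A' i) ≠ ∞ := measure_ne_top_of_subset (hA i).2.2 measure_ball_lt_top.ne
  have hsymm : volume (Metric.ball 0 (a i) \ A' i) = volume (A' i \ Metric.ball 0 (a i)) := by
    have h1 := measure_inter_add_sdiff (μ := volume) (A' i) (hK i)
    have h2 := measure_inter_add_sdiff (μ := volume) (Metric.ball 0 (a i)) (hA i).1
    rw [← hvol i, ← (hA i).2.1, ← h1, inter_comm] at h2
    exact (ENNReal.add_right_inj (hfin _ _)).1 h2
  have hi : (volume (A' i ∩ Metric.ball 0 (a i))).toReal +
      (volume (A' i \ Metric.ball 0 (a i))).toReal ^ 2 / V.toReal ≤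
      (volume (S (A' i) ∩ Metric.ball 0 (a i))).toReal := by
    have h1 := ENNReal.toReal_mono (hfin _ _) (hS4 _ _ (ha i) (hA i).1)
    rw [ENNReal.toReal_add (hfin _ _) hDt] at h1
    rw [hsymm] at hv
    have h2 := ENNReal.toReal_mono (ENNReal.mul_ne_top hVt hDt) hv
    rw [ENNReal.toReal_mul, ENNReal.toReal_mul] at h2
    have h3 : (volume (A' i \ Metric.ball 0 (a i))).toReal ^ 2 / V.toReal ≤ D.toReal := by
      rw [div_le_iff₀ (ENNReal.toReal_pos hV0 hVt)]
      linarith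
    linarith
  rw [← Finset.add_sum_erase _ _ (Finset.mem_univ i),
    ← Finset.add_sum_erase _ _ (Finset.mem_univ i)]
  have := Finset.sum_le_sum (s := Finset.univ.erase i) fun j _ => hmono j
  linarith

theorem IsRearrangement.exists_close {n : ℕ} {R : ℝ} (hR : 0 < R)
    {A : Fin 3 → Set (EuclideanSpace ℝ (Fin (n + 1)))} {a : Fin 3 → ℝ} (ha : ∀ i, 0 ≤ a i)
    (haR : ∀ i, a i ≤ R)
    (hvol : ∀ i, volume (A i) = volume (Metric.ball (0 : EuclideanSpace ℝ (Fin (n + 1))) (a i)))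
    (h : IsRearrangement R A A) {ε : ℝ} (hε : 0 < ε) :
    ∃ A', IsRearrangement R A A' ∧
      ∀ i, (volume (A' i \ Metric.ball 0 (a i))).toReal ≤ ε := by
  by_contra! hcon
  set V := volume (Metric.ball (0 : EuclideanSpace ℝ (Fin (n + 1))) (2 * R)) with hV
  have hV0 : 0 < V.toReal := ENNReal.toReal_pos
    (Metric.measure_ball_pos _ _ (by linarith)).ne' measure_ball_lt_top.ne
  have key : ∀ k : ℕ, ∃ A', IsRearrangement R A A' ∧
      k * (ε ^ 2 / V.toReal) ≤ ∑ j, (volume (A' j ∩ Metric.ball 0 (a j))).toReal := by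
    intro k
    induction k with
    | zero => exact ⟨A, h, by simpa using Finset.sum_nonneg fun _ _ => ENNReal.toReal_nonneg⟩
    | succ k ih =>
      obtain ⟨A', h1, h2⟩ := ih
      obtain ⟨i, hi⟩ := hcon A' h1
      obtain ⟨A'', h3, h4⟩ := h1.exists_improvement hR ha haR hvol i
      refine ⟨A'', h3, le_trans ?_ h4⟩
      have : ε ^ 2 / V.toReal ≤ (volume (A' i \ Metric.ball 0 (a i))).toReal ^ 2 / V.toReal := by
        gcongr
      push_cast
      linarith
  obtain ⟨k, hk⟩ := exists_lt_nsmul (show 0 < ε ^ 2 / V.toReal by positivity)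
    (∑ j, (volume (Metric.ball (0 : EuclideanSpace ℝ (Fin (n + 1))) (a j))).toReal)
  obtain ⟨A', -, h2⟩ := key k
  rw [nsmul_eq_mul] at hk
  refine absurd (hk.trans_le h2) (not_lt.2 (Finset.sum_le_sum fun j _ =>
    ENNReal.toReal_mono measure_ball_lt_top.ne (measure_mono inter_subset_right)))

theorem additivePairs_le_ball_of_subset {n : ℕ} {R : ℝ} (hR : 0 < R)
    {A : Fin 3 → Set (EuclideanSpace ℝ (Fin (n + 1)))} {a : Fin 3 → ℝ} (ha : ∀ i, 0 ≤ a i)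
    (haR : ∀ i, a i ≤ R) (hA : ∀ i, MeasurableSet (A i)) (hAR : ∀ i, A i ⊆ Metric.ball 0 R)
    (hvol : ∀ i, volume (A i) = volume (Metric.ball (0 : EuclideanSpace ℝ (Fin (n + 1))) (a i))) :
    additivePairs (A 0) (A 1) (A 2) ≤
      additivePairs (Metric.ball (0 : EuclideanSpace ℝ (Fin (n + 1))) (a 0)) (Metric.ball 0 (a 1))
        (Metric.ball 0 (a 2)) := by
  have hfin : ∀ i, volume (A i) ≠ ∞ := fun i =>
    measure_ne_top_of_subset (hAR i) measure_ball_lt_top.ne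
  set T : ℝ≥0∞ := volume (A 1) + volume (A 0) + volume (A 0) with hT
  have hTt : T ≠ ∞ := by simp [hT, hfin]
  have key : ∀ ε : ℝ, 0 < ε → additivePairs (A 0) (A 1) (A 2) ≤
      additivePairs (Metric.ball (0 : EuclideanSpace ℝ (Fin (n + 1))) (a 0)) (Metric.ball 0 (a 1))
        (Metric.ball 0 (a 2)) +
        ENNReal.ofReal ε * T := by
    intro ε hε
    obtain ⟨A', ⟨h1, h2⟩, h3⟩ := IsRearrangement.exists_close hR ha haR hvol
      ⟨fun i => ⟨hA i, rfl, hAR i⟩, le_rfl⟩ hε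
    have h4 : ∀ i, volume (A' i \ Metric.ball 0 (a i)) ≤ ENNReal.ofReal ε := fun i => by
      refine ENNReal.le_ofReal_iff_toReal_le ?_ hε.le |>.2 (h3 i)
      exact measure_ne_top_of_subset (sdiff_subset.trans (h1 i).2.2) measure_ball_lt_top.ne
    refine h2.trans ((additivePairs_le_add_diff _ _ _ (Metric.ball 0 (a 0)) (Metric.ball 0 (a 1))
      (Metric.ball 0 (a 2))).trans ?_)
    rw [(h1 0).2.1, (h1 1).2.1, hT, mul_add, mul_add, ← add_assoc, ← add_assoc,
      mul_comm (ENNReal.ofReal ε) (volume (A 0))]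
    gcongr
    all_goals first | exact le_rfl | exact h4 _
  refine ge_of_tendsto (x := nhdsWithin (0 : ℝ) (Ioi 0)) ?_ (eventually_mem_nhdsWithin.mono key)
  have : Filter.Tendsto (fun ε : ℝ => ENNReal.ofReal ε * T) (nhdsWithin 0 (Ioi 0)) (nhds 0) := by
    have h0 : Filter.Tendsto (fun ε : ℝ => ENNReal.ofReal ε) (nhdsWithin 0 (Ioi 0)) (nhds 0) := by
      have := (ENNReal.continuous_ofReal.tendsto 0).mono_left (nhdsWithin_le_nhds (s := Ioi 0))
      simpa using this
    have h5 := ENNReal.Tendsto.mul_const h0 (Or.inr hTt)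
    simpa using h5
  simpa using tendsto_const_nhds.add this

theorem additivePairs_le_ball {n : ℕ} {A B C : Set (EuclideanSpace ℝ (Fin (n + 1)))} {a b c : ℝ}
    (ha : 0 ≤ a) (hb : 0 ≤ b) (hc : 0 ≤ c)
    (hA : MeasurableSet A) (hB : MeasurableSet B) (hC : MeasurableSet C)
    (hAa : volume A = volume (Metric.ball (0 : EuclideanSpace ℝ (Fin (n + 1))) a))
    (hBb : volume B = volume (Metric.ball (0 : EuclideanSpace ℝ (Fin (n + 1))) b))
    (hCc : volume C = volume (Metric.ball (0 : EuclideanSpace ℝ (Fin (n + 1))) c)) :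
    additivePairs A B C ≤
      additivePairs (Metric.ball (0 : EuclideanSpace ℝ (Fin (n + 1))) a) (Metric.ball 0 b)
        (Metric.ball 0 c) := by
  have hU : {p : EuclideanSpace ℝ (Fin (n + 1)) × EuclideanSpace ℝ (Fin (n + 1)) |
      p.1 ∈ A ∧ p.2 ∈ B ∧ p.1 + p.2 ∈ C} = ⋃ k : ℕ,
      {p | p.1 ∈ A ∩ Metric.ball 0 k ∧ p.2 ∈ B ∩ Metric.ball 0 k ∧
        p.1 + p.2 ∈ C ∩ Metric.ball 0 k} := by
    ext p
    simp only [mem_ofPred_eq, mem_iUnion, mem_inter_iff, mem_ball_zero_iff]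
    constructor
    · rintro ⟨h1, h2, h3⟩
      obtain ⟨k, hk⟩ := exists_nat_gt (max ‖p.1‖ (max ‖p.2‖ ‖p.1 + p.2‖))
      simp only [max_lt_iff] at hk
      exact ⟨k, ⟨h1, hk.1⟩, ⟨h2, hk.2.1⟩, h3, hk.2.2⟩
    · rintro ⟨k, ⟨h1, -⟩, ⟨h2, -⟩, h3, -⟩
      exact ⟨h1, h2, h3⟩
  have hmono : Monotone fun k : ℕ =>
      {p : EuclideanSpace ℝ (Fin (n + 1)) × EuclideanSpace ℝ (Fin (n + 1)) |
        p.1 ∈ A ∩ Metric.ball 0 k ∧ p.2 ∈ B ∩ Metric.ball 0 k ∧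
        p.1 + p.2 ∈ C ∩ Metric.ball 0 k} := by
    intro k l hkl p
    have hs : Metric.ball (0 : EuclideanSpace ℝ (Fin (n + 1))) k ⊆ Metric.ball 0 l :=
      Metric.ball_subset_ball (by exact_mod_cast hkl)
    rintro ⟨⟨h1, h1'⟩, ⟨h2, h2'⟩, h3, h3'⟩
    exact ⟨⟨h1, hs h1'⟩, ⟨h2, hs h2'⟩, h3, hs h3'⟩
  refine le_of_tendsto' (x := Filter.atTop) (f := fun k : ℕ => additivePairs (A ∩ Metric.ball 0 k)
    (B ∩ Metric.ball 0 k) (C ∩ Metric.ball 0 k)) ?_ fun k => ?_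
  · have := tendsto_measure_iUnion_atTop (μ := volume) hmono
    rwa [← hU] at this
  set W : Fin 3 → Set (EuclideanSpace ℝ (Fin (n + 1))) := ![A, B, C] with hW
  set w : Fin 3 → ℝ := ![a, b, c] with hw
  have hw0 : ∀ i, 0 ≤ w i := by intro i; fin_cases i <;> simpa [hw]
  have hWm : ∀ i, MeasurableSet (W i) := by intro i; fin_cases i <;> simpa [hW]
  have hWv : ∀ i, volume (W i) =
      volume (Metric.ball (0 : EuclideanSpace ℝ (Fin (n + 1))) (w i)) := by
    intro i; fin_cases i <;> simpa [hW, hw]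
  have hex : ∀ i, ∃ r : ℝ, 0 ≤ r ∧ volume (Metric.ball (0 : EuclideanSpace ℝ (Fin (n + 1))) r) =
      volume (W i ∩ Metric.ball 0 (k : ℝ)) := fun i =>
    exists_volume_ball_eq (measure_ne_top_of_subset inter_subset_right measure_ball_lt_top.ne)
  choose r hr0 hr using hex
  have hrw : ∀ i, r i ≤ w i := fun i => le_of_volume_ball_le (hw0 i) (by
    rw [hr, ← hWv]; exact measure_mono inter_subset_left)
  rcases Nat.eq_zero_or_pos k with rfl | hk
  · have : additivePairs (A ∩ Metric.ball 0 ((0 : ℕ) : ℝ)) (B ∩ Metric.ball 0 ((0 : ℕ) : ℝ))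
        (C ∩ Metric.ball 0 ((0 : ℕ) : ℝ)) = 0 := by simp [additivePairs]
    rw [this]; exact zero_le
  have hk' : (0 : ℝ) < k := by exact_mod_cast hk
  have hrk : ∀ i, r i ≤ k := fun i => le_of_volume_ball_le hk'.le (by
    rw [hr]; exact measure_mono inter_subset_right)
  have := additivePairs_le_ball_of_subset hk' hr0 hrk
    (fun i => (hWm i).inter Metric.isOpen_ball.measurableSet) (fun i => inter_subset_right)
    (fun i => (hr i).symm)
  refine this.trans (additivePairs_mono ?_ ?_ ?_)
  · exact Metric.ball_subset_ball (hrw 0)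
  · exact Metric.ball_subset_ball (hrw 1)
  · exact Metric.ball_subset_ball (hrw 2)

/-- The measure of the set of `y ∈ B` for which `x ∈ A + y`. -/
noncomputable def overlap {G : Type*} [AddGroup G] [MeasureSpace G] (A B : Set G) (x : G) : ℝ≥0∞ :=
  volume {y | y ∈ B ∧ x - y ∈ A}

theorem overlap_le {G : Type*} [AddGroup G] [MeasureSpace G] (A B : Set G) (x : G) :
    overlap A B x ≤ volume B :=
  measure_mono fun _ h => h.1

section overlap

variable {G : Type*} [AddCommGroup G] [MeasureSpace G] [MeasurableAdd₂ G]
  [MeasurableNeg G] [SFinite (volume : Measure G)] {A B : Set G}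

theorem measurable_overlap (hA : MeasurableSet A) (hB : MeasurableSet B) :
    Measurable (overlap A B) :=
  measurable_measure_prodMk_left (ν := volume) (s := {p : G × G | p.2 ∈ B ∧ p.1 - p.2 ∈ A})
    ((measurable_snd hB).inter (measurable_sub hA))

theorem setLIntegral_overlap [(volume : Measure G).IsAddLeftInvariant] (hA : MeasurableSet A)
    (hB : MeasurableSet B) {C : Set G} (hC : MeasurableSet C) :
    ∫⁻ x in C, overlap A B x = additivePairs A B C := by
  have hm : MeasurableSet {p : G × G | p.2 ∈ B ∧ p.1 - p.2 ∈ A} :=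
    (measurable_snd hB).inter (measurable_sub hA)
  have hm' : MeasurableSet {p : G × G | p.1 ∈ C ∧ p.2 ∈ B ∧ p.1 - p.2 ∈ A} :=
    (measurable_fst hC).inter hm
  have h1 : ∫⁻ x in C, overlap A B x =
      volume {p : G × G | p.1 ∈ C ∧ p.2 ∈ B ∧ p.1 - p.2 ∈ A} := by
    rw [← lintegral_indicator hC, Measure.volume_eq_prod, Measure.prod_apply hm']
    refine lintegral_congr fun x => ?_
    by_cases hx : x ∈ C
    · rw [indicator_of_mem hx]
      simp [overlap, hx]
    · rw [indicator_of_notMem hx]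
      simp [hx]
  rw [h1, additivePairs_comm, additivePairs, Measure.volume_eq_prod, Measure.prod_apply_symm hm',
    Measure.prod_apply (measurableSet_additivePairs hB hA hC)]
  refine lintegral_congr fun y => ?_
  rw [← measure_preimage_add volume y]
  congr 1
  ext x
  simp only [mem_preimage, mem_ofPred_eq]
  rw [add_sub_cancel_left]
  tauto

theorem lintegral_overlap [(volume : Measure G).IsAddLeftInvariant] (hA : MeasurableSet A)
    (hB : MeasurableSet B) : ∫⁻ x, overlap A B x = volume A * volume B := by
  rw [← setLIntegral_univ, setLIntegral_overlap hA hB MeasurableSet.univ, additivePairs,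
    ← Measure.prod_prod, Measure.volume_eq_prod]
  congr 1
  ext p
  simp

end overlap

theorem lintegral_min_overlap_ball_le {n : ℕ} {A B : Set (EuclideanSpace ℝ (Fin (n + 1)))} {a b : ℝ}
    (ha : 0 ≤ a) (hb : 0 ≤ b) (hA : MeasurableSet A) (hB : MeasurableSet B)
    (hAa : volume A = volume (Metric.ball (0 : EuclideanSpace ℝ (Fin (n + 1))) a))
    (hBb : volume B = volume (Metric.ball (0 : EuclideanSpace ℝ (Fin (n + 1))) b))
    {s : ℝ≥0∞} (hs : s ≠ 0) (hs' : s ≠ ∞) :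
    ∫⁻ x, min (overlap (Metric.ball (0 : EuclideanSpace ℝ (Fin (n + 1))) a) (Metric.ball 0 b) x) s ≤
      ∫⁻ x, min (overlap A B x) s := by
  set P := overlap A B with hP
  set Q := overlap (Metric.ball (0 : EuclideanSpace ℝ (Fin (n + 1))) a) (Metric.ball 0 b) with hQ
  have hPm : Measurable P := measurable_overlap hA hB
  have hbm : ∀ r, MeasurableSet (Metric.ball (0 : EuclideanSpace ℝ (Fin (n + 1))) r) :=
    fun r => Metric.isOpen_ball.measurableSet
  have hQm : Measurable Q := measurable_overlap (hbm _) (hbm _)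
  have hPi : ∫⁻ x, P x = volume A * volume B := lintegral_overlap hA hB
  have hQi : ∫⁻ x, Q x = volume A * volume B := by
    rw [lintegral_overlap (hbm _) (hbm _), hAa, hBb]
  have hfin : volume A * volume B ≠ ∞ := by
    rw [hAa, hBb]; exact ENNReal.mul_ne_top measure_ball_lt_top.ne measure_ball_lt_top.ne
  set F := {x | s < P x} with hF
  have hFm : MeasurableSet F := measurableSet_lt measurable_const hPm
  have hFt : volume F ≠ ∞ := by
    have h1 : s * volume F ≤ volume A * volume B := by
      rw [← hPi]
      refine le_trans ?_ (mul_meas_ge_le_lintegral hPm s)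
      gcongr
      exact fun x (hx : s < P x) => hx.le
    intro h
    rw [h, ENNReal.mul_top hs] at h1
    exact hfin (top_le_iff.1 h1)
  obtain ⟨c, hc, hcF⟩ := exists_volume_ball_eq (E := EuclideanSpace ℝ (Fin (n + 1))) hFt
  have hriesz : ∫⁻ x in F, P x ≤ ∫⁻ x in Metric.ball 0 c, Q x := by
    rw [setLIntegral_overlap hA hB hFm, setLIntegral_overlap (hbm _) (hbm _) (hbm _)]
    exact additivePairs_le_ball ha hb hc hA hB hFm hAa hBb hcF.symm
  have hexc : ∫⁻ x, (P x - s) ≤ ∫⁻ x, (Q x - s) := by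
    have h1 : ∫⁻ x, (P x - s) = ∫⁻ x in F, (P x - s) := by
      refine (setLIntegral_eq_of_support_subset ?_).symm
      intro x hx
      exact tsub_pos_iff_lt.1 (pos_iff_ne_zero.2 hx)
    have h2 : (∫⁻ x in F, (P x - s)) + s * volume F = ∫⁻ x in F, P x := by
      rw [← setLIntegral_const, ← lintegral_add_right _ measurable_const]
      exact setLIntegral_congr_fun hFm fun x hx => tsub_add_cancel_of_le (le_of_lt hx)
    have h3 : ∫⁻ x in Metric.ball 0 c, Q x ≤
        (∫⁻ x in Metric.ball 0 c, (Q x - s)) + s * volume F := by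
      rw [← hcF, ← setLIntegral_const, ← lintegral_add_right _ measurable_const]
      exact lintegral_mono fun x => le_tsub_add
    have h4 := h2.le.trans (hriesz.trans h3)
    rw [ENNReal.add_le_add_iff_right (ENNReal.mul_ne_top hs' hFt)] at h4
    rw [h1]
    exact h4.trans (setLIntegral_le_lintegral _ _)
  have hsplit : ∀ f : EuclideanSpace ℝ (Fin (n + 1)) → ℝ≥0∞, Measurable f →
      (∫⁻ x, min (f x) s) + ∫⁻ x, (f x - s) = ∫⁻ x, f x := by
    intro f hf
    rw [← lintegral_add_left (hf.min measurable_const)]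
    refine lintegral_congr fun x => ?_
    rcases le_total (f x) s with h | h
    · rw [min_eq_left h, tsub_eq_zero_of_le h, add_zero]
    · rw [min_eq_right h, add_tsub_cancel_of_le h]
  have hQe : ∫⁻ x, (Q x - s) ≠ ∞ :=
    ne_top_of_le_ne_top (hQi ▸ hfin) (lintegral_mono fun x => tsub_le_self)
  have h5 := (hsplit Q hQm).trans (hQi.trans (hPi.symm.trans (hsplit P hPm).symm))
  rw [← ENNReal.add_le_add_iff_right hQe, h5]
  gcongr

theorem box_subset_prodBall {n : ℕ} {m r R h w : ℝ} (hh : 0 < h) (hhr : h ≤ 2 * r) (hrR : r ≤ R)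
    (hm : |m| ≤ R - h / 2) (hw : n * w ^ 2 ≤ r * h / 4) {p : ℝ × (Fin n → ℝ)}
    (h1 : |p.1 - m| < h / 4) (h2 : ∀ i, |p.2 i| < w) : p ∈ prodBall n R := by
  have h3 : ∑ i, p.2 i ^ 2 ≤ r * h / 4 := by
    refine le_trans (Finset.sum_le_card_nsmul _ _ (w ^ 2) fun i _ => ?_) (by simpa using hw)
    rw [← sq_abs]
    exact pow_le_pow_left₀ (abs_nonneg _) (h2 i).le 2
  have h4 : |p.1| < R - h / 4 := by
    have := abs_sub_abs_le_abs_sub p.1 m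
    linarith
  have h5 : p.1 ^ 2 < (R - h / 4) ^ 2 := by
    rw [← sq_abs]
    exact pow_lt_pow_left₀ h4 (abs_nonneg _) two_ne_zero
  show p.1 ^ 2 + ∑ i, p.2 i ^ 2 < R ^ 2
  nlinarith [mul_nonneg hh.le (sub_nonneg.2 hhr), mul_nonneg hh.le (sub_nonneg.2 hrR)]

theorem le_overlap_ball {n : ℕ} {a b r h w : ℝ} (hra : r ≤ a) (hrb : r ≤ b) (hh : 0 < h)
    (hhr : h ≤ 2 * r) (hw0 : 0 ≤ w) (hw : n * w ^ 2 ≤ r * h / 4)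
    {x : EuclideanSpace ℝ (Fin (n + 1))} (hx : ‖x‖ ≤ a + b - h) :
    ENNReal.ofReal (h / 2 * (2 * w) ^ n) ≤
      overlap (Metric.ball (0 : EuclideanSpace ℝ (Fin (n + 1))) a) (Metric.ball 0 b) x := by
  obtain ⟨Φ, hΦ, hadd, hv, hball⟩ := exists_measurableEquiv_prod x
  set m := min ‖x‖ (b - h / 2) with hm
  have hm0 : 0 ≤ m := le_min (norm_nonneg _) (by linarith)
  have hmb : m ≤ b - h / 2 := min_le_right _ _
  have hmx : m ≤ ‖x‖ := min_le_left _ _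
  have hma : ‖x‖ - m ≤ a - h / 2 := by
    rcases min_choice ‖x‖ (b - h / 2) with h' | h' <;> rw [hm, h'] <;> linarith
  have hvol : volume (Ioo (m - h / 4) (m + h / 4) ×ˢ univ.pi fun _ : Fin n => Ioo (-w) w) =
      ENNReal.ofReal (h / 2 * (2 * w) ^ n) := by
    rw [Measure.volume_eq_prod, Measure.prod_prod, Real.volume_Ioo, Real.volume_pi_Ioo,
      ENNReal.ofReal_mul (by positivity), ENNReal.ofReal_pow (by positivity)]
    simp only [Finset.prod_const, Finset.card_univ, Fintype.card_fin]
    congr 3 <;> ring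
  rw [← hvol, ← hΦ.measure_preimage_equiv]
  refine measure_mono fun y hy => ?_
  obtain ⟨h1, h2⟩ := hy
  have h3 : |(Φ y).1 - m| < h / 4 := by
    rw [abs_lt]; constructor <;> linarith [h1.1, h1.2]
  have h4 : ∀ i, |(Φ y).2 i| < w := fun i => abs_lt.2 (h2 i (mem_univ i))
  have h5 : Φ (x - y) = (‖x‖ - (Φ y).1, -(Φ y).2) := by
    have := hadd (x - y) y
    rw [sub_add_cancel, hv] at this
    rw [eq_sub_of_add_eq this.symm]
    ext <;> simp
  constructor
  · rw [← hball b (by linarith)]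
    exact box_subset_prodBall hh hhr hrb (by rwa [abs_of_nonneg hm0]) hw h3 h4
  · rw [← hball a (by linarith)]
    refine box_subset_prodBall (m := ‖x‖ - m) hh hhr hra
      (by rwa [abs_of_nonneg (by linarith)]) hw ?_ ?_
    · rw [h5]
      convert h3 using 1
      rw [abs_sub_comm]
      congr 1
      ring
    · rw [h5]
      simpa using h4

theorem exists_le_overlap_ball (n : ℕ) {μ : ℝ} (hμ : 0 < μ) :
    ∃ K : ℝ, 0 < K ∧ ∀ a b u : ℝ, 0 < b → 0 < u → μ * b ≤ a → μ ≤ 1 → K * u ^ 2 ≤ 2 * μ →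
      ∀ x : EuclideanSpace ℝ (Fin (n + 1)), ‖x‖ ≤ a + b - K * u ^ 2 * b →
        ENNReal.ofReal (u ^ (n + 2)) * volume (Metric.ball (0 : EuclideanSpace ℝ (Fin (n + 1))) b) ≤
          overlap (Metric.ball (0 : EuclideanSpace ℝ (Fin (n + 1))) a) (Metric.ball 0 b) x := by
  set ω := volume (Metric.ball (0 : EuclideanSpace ℝ (Fin (n + 1))) 1) with hω
  set K : ℝ := max (2 * ω.toReal) ((n + 1) / μ) with hK
  have hn : (0 : ℝ) < n + 1 := by positivity
  have hK0 : 0 < K := lt_max_of_lt_right (by positivity)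
  set g := √(μ * K / (4 * (n + 1))) with hg
  have hg2 : g ^ 2 = μ * K / (4 * (n + 1)) := Real.sq_sqrt (by positivity)
  have hg1 : 1 ≤ 2 * g := by
    have h1 : (n + 1) / μ ≤ K := le_max_right _ _
    rw [div_le_iff₀ hμ] at h1
    have h2 : (1 / 2 : ℝ) ≤ g := by
      refine Real.le_sqrt_of_sq_le ?_
      rw [le_div_iff₀ (by positivity)]
      linarith
    linarith
  have hg0 : 0 ≤ g := Real.sqrt_nonneg _
  refine ⟨K, hK0, fun a b u hb hu ha hμ1 hKu x hx => ?_⟩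
  have h1 := le_overlap_ball (n := n) (a := a) (b := b) (r := μ * b) (h := K * u ^ 2 * b)
    (w := u * b * g) ha (by nlinarith) (by positivity) (by nlinarith) (by positivity)
    (by
      rw [mul_pow, hg2]
      have : (n : ℝ) * ((u * b) ^ 2 * (μ * K / (4 * (n + 1)))) =
          n / (n + 1) * (μ * b * (K * u ^ 2 * b) / 4) := by field_simp
      rw [this]
      refine mul_le_of_le_one_left (by positivity) ?_
      rw [div_le_one hn]
      linarith) hx
  refine le_trans ?_ h1
  rw [Measure.addHaar_ball _ _ hb.le, ← hω, ← ENNReal.ofReal_toReal (a := ω) measure_ball_lt_top.ne,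
    ← ENNReal.ofReal_mul (by positivity), ← ENNReal.ofReal_mul (by positivity)]
  refine ENNReal.ofReal_le_ofReal ?_
  simp only [finrank_euclideanSpace, Fintype.card_fin]
  have h2 : K * u ^ 2 * b / 2 * (2 * (u * b * g)) ^ n =
      u ^ (n + 2) * (b ^ (n + 1) * (K / 2 * (2 * g) ^ n)) := by
    rw [mul_pow, mul_pow, mul_pow, mul_pow]; ring
  rw [h2]
  have h3 : ω.toReal ≤ K / 2 * (2 * g) ^ n := by
    have h4 : 2 * ω.toReal ≤ K := le_max_left _ _
    have h5 : 1 ≤ (2 * g) ^ n := one_le_pow₀ hg1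
    nlinarith
  gcongr

theorem exists_le_lintegral_min_overlap_ball (n : ℕ) {τ : ℝ} (hτ : 0 < τ) :
    ∃ C : ℝ, 0 < C ∧ ∀ b u : ℝ, 0 < b → 0 < u →
      ENNReal.ofReal (u ^ (n + 2)) * volume (Metric.ball (0 : EuclideanSpace ℝ (Fin (n + 1))) b) *
        (ENNReal.ofReal (1 - C * u ^ 2) *
          volume (Metric.ball (0 : EuclideanSpace ℝ (Fin (n + 1))) (τ * b + b))) ≤
      ∫⁻ x, min (overlap (Metric.ball (0 : EuclideanSpace ℝ (Fin (n + 1))) (τ * b))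
        (Metric.ball 0 b) x)
        (ENNReal.ofReal (u ^ (n + 2)) *
          volume (Metric.ball (0 : EuclideanSpace ℝ (Fin (n + 1))) b)) := by
  set μ := min τ 1 with hμdef
  have hμ : 0 < μ := lt_min hτ one_pos
  have hμτ : μ ≤ τ := min_le_left _ _
  have hμ1 : μ ≤ 1 := min_le_right _ _
  obtain ⟨K, hK, hKP⟩ := exists_le_overlap_ball n hμ
  refine ⟨(n + 1) * K + K / (2 * μ), by positivity, fun b u hb hu => ?_⟩
  set C := (n + 1) * K + K / (2 * μ) with hC
  rcases lt_or_ge (2 * μ) (K * u ^ 2) with hlt | hle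
  · have : 1 - C * u ^ 2 ≤ 0 := by
      have h1 : 1 ≤ K / (2 * μ) * u ^ 2 := by
        rw [div_mul_eq_mul_div, one_le_div (by positivity)]
        exact hlt.le
      have h2 : 0 ≤ (n + 1) * K * u ^ 2 := by positivity
      rw [hC]; nlinarith
    rw [ENNReal.ofReal_of_nonpos this]
    simp
  set σ := ENNReal.ofReal (u ^ (n + 2)) *
    volume (Metric.ball (0 : EuclideanSpace ℝ (Fin (n + 1))) b) with hσ
  set h := K * u ^ 2 * b with hh
  have hh0 : 0 ≤ h := by positivity
  have hhR : h ≤ τ * b + b := by rw [hh]; nlinarith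
  have h1 : ∫⁻ x in Metric.ball (0 : EuclideanSpace ℝ (Fin (n + 1))) (τ * b + b - h), σ ≤
      ∫⁻ x, min (overlap (Metric.ball (0 : EuclideanSpace ℝ (Fin (n + 1))) (τ * b))
        (Metric.ball 0 b) x) σ := by
    refine le_trans (setLIntegral_mono' Metric.isOpen_ball.measurableSet fun x hx => ?_)
      (setLIntegral_le_lintegral _ _)
    refine le_min (hKP (τ * b) b u hb hu (by gcongr) hμ1 hle x ?_) le_rfl
    exact (mem_ball_zero_iff.1 hx).le
  refine le_trans ?_ h1
  rw [setLIntegral_const]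
  gcongr
  rw [Measure.addHaar_ball _ _ (by positivity), Measure.addHaar_ball _ _ (sub_nonneg.2 hhR),
    ← mul_assoc]
  gcongr
  rw [← ENNReal.ofReal_mul' (by positivity)]
  refine ENNReal.ofReal_le_ofReal ?_
  simp only [finrank_euclideanSpace, Fintype.card_fin]
  set R := τ * b + b with hR
  have hR0 : 0 < R := by positivity
  have h2 : (R - h) ^ (n + 1) = (1 + -(h / R)) ^ (n + 1) * R ^ (n + 1) := by
    rw [← mul_pow]; congr 1; field_simp; ring
  rw [h2]
  gcongr
  have h3 : h / R ≤ 1 := (div_le_one hR0).2 hhR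
  refine le_trans ?_ (one_add_mul_le_pow (by linarith) (n + 1))
  have h4 : h / R ≤ K * u ^ 2 := by
    rw [div_le_iff₀ hR0, hh]
    gcongr
    nlinarith
  have h5 : 0 ≤ K / (2 * μ) * u ^ 2 := by positivity
  push_cast
  rw [hC]
  nlinarith [mul_le_mul_of_nonneg_left h4 (by positivity : (0 : ℝ) ≤ n + 1)]

section expectation

variable {G : Type*} [AddCommGroup G] [MeasureSpace G] [MeasurableAdd₂ G]
  [SigmaFinite (volume : Measure G)] {A B : Set G}

theorem setLIntegral_volume_iUnion_translate [MeasurableNeg G] {n : ℕ} (hA : MeasurableSet A)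
    (hB : MeasurableSet B) (hBt : volume B ≠ ∞) :
    ∫⁻ b in univ.pi fun _ : Fin n => B, volume (⋃ i, (· + b i) '' A) =
      ∫⁻ x, (volume B ^ n - (volume B - overlap A B x) ^ n) := by
  have hpi : MeasurableSet (univ.pi fun _ : Fin n => B) := MeasurableSet.univ_pi fun _ => hB
  have hm : MeasurableSet {p : (Fin n → G) × G | ∃ i, p.2 - p.1 i ∈ A} := by
    rw [ofPred_exists]
    refine MeasurableSet.iUnion fun i => ?_
    exact (measurable_snd.sub ((measurable_pi_apply i).comp measurable_fst)) hA
  have hm' : MeasurableSet {p : (Fin n → G) × G |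
      p.1 ∈ univ.pi (fun _ : Fin n => B) ∧ ∃ i, p.2 - p.1 i ∈ A} :=
    (measurable_fst hpi).inter hm
  have himage : ∀ b : Fin n → G, (⋃ i, (· + b i) '' A) = {x | ∃ i, x - b i ∈ A} := by
    intro b
    ext x
    simp [sub_eq_add_neg]
  have h1 : ∫⁻ b in univ.pi fun _ : Fin n => B, volume (⋃ i, (· + b i) '' A) =
      (volume.prod volume) {p : (Fin n → G) × G |
        p.1 ∈ univ.pi (fun _ : Fin n => B) ∧ ∃ i, p.2 - p.1 i ∈ A} := by
    rw [← lintegral_indicator hpi, Measure.prod_apply hm']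
    refine lintegral_congr fun b => ?_
    by_cases hb : b ∈ univ.pi fun _ : Fin n => B
    · rw [indicator_of_mem hb, himage]
      congr 1
      ext x
      simp only [mem_preimage, mem_ofPred_eq, hb, true_and]
    · rw [indicator_of_notMem hb, ← measure_empty (μ := (volume : Measure G))]
      congr 1
      ext x
      simp only [mem_preimage, mem_ofPred_eq, hb, false_and, mem_empty_iff_false]
  rw [h1, Measure.prod_apply_symm hm']
  refine lintegral_congr fun x => ?_
  have hOm : MeasurableSet {y | y ∈ B ∧ x - y ∈ A} :=
    hB.inter (measurable_const.sub measurable_id hA)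
  have hOs : {y | y ∈ B ∧ x - y ∈ A} ⊆ B := fun y hy => hy.1
  have hset : (fun b => (b, x)) ⁻¹' {p : (Fin n → G) × G |
      p.1 ∈ univ.pi (fun _ : Fin n => B) ∧ ∃ i, p.2 - p.1 i ∈ A} =
      (univ.pi fun _ : Fin n => B) \ univ.pi fun _ => B \ {y | y ∈ B ∧ x - y ∈ A} := by
    ext b
    simp only [mem_preimage, mem_ofPred_eq, mem_sdiff, mem_univ_pi]
    constructor
    · rintro ⟨h2, i, hi⟩
      exact ⟨h2, fun h3 => (h3 i).2 ⟨h2 i, hi⟩⟩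
    · rintro ⟨h2, h3⟩
      refine ⟨h2, ?_⟩
      by_contra! h4
      exact h3 fun i => ⟨h2 i, fun h5 => h4 i h5.2⟩
  have hdm : MeasurableSet (univ.pi fun _ : Fin n => B \ {y | y ∈ B ∧ x - y ∈ A}) :=
    MeasurableSet.univ_pi fun _ => hB.diff hOm
  have hvol : volume (univ.pi fun _ : Fin n => B \ {y | y ∈ B ∧ x - y ∈ A}) =
      (volume B - overlap A B x) ^ n := by
    rw [volume_pi_pi, measure_sdiff hOs hOm.nullMeasurableSet (measure_ne_top_of_subset hOs hBt)]
    simp [overlap]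
  rw [hset, measure_sdiff (pi_mono fun _ _ => sdiff_subset) hdm.nullMeasurableSet,
    hvol, volume_pi_pi]
  · simp
  · rw [hvol]
    exact ENNReal.pow_ne_top (ne_top_of_le_ne_top hBt tsub_le_self)

theorem expectation_volume_iUnion_translate [MeasurableNeg G] {n : ℕ} (hA : MeasurableSet A)
    (hB : MeasurableSet B) (hB0 : volume B ≠ 0) (hBt : volume B ≠ ∞) :
    (∏ _i : Fin n, volume B)⁻¹ *
      ∫⁻ b in univ.pi fun _ : Fin n => B, volume (⋃ i, (· + b i) '' A) =
      ∫⁻ x, (1 - (1 - overlap A B x / volume B) ^ n) := by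
  rw [setLIntegral_volume_iUnion_translate hA hB hBt, Finset.prod_const, Finset.card_univ,
    Fintype.card_fin, ← lintegral_const_mul' _ _
      (ENNReal.inv_ne_top.2 (pow_ne_zero _ hB0))]
  refine lintegral_congr fun x => ?_
  have h0 : volume B ^ n ≠ 0 := pow_ne_zero _ hB0
  have ht : volume B ^ n ≠ ∞ := ENNReal.pow_ne_top hBt
  rw [ENNReal.mul_sub fun _ _ => ENNReal.inv_ne_top.2 h0, ENNReal.inv_mul_cancel h0 ht,
    ENNReal.inv_pow, ← mul_pow, ENNReal.mul_sub fun _ _ => ENNReal.inv_ne_top.2 hB0,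
    ENNReal.inv_mul_cancel hB0 hBt, ENNReal.div_eq_inv_mul]

theorem expectation_volume_iUnion_translate_ne_top {n : ℕ}
    [(volume : Measure G).IsAddRightInvariant]
    (hAt : volume A ≠ ∞) (hB0 : volume B ≠ 0) (hBt : volume B ≠ ∞) :
    (∏ _i : Fin n, volume B)⁻¹ *
      ∫⁻ b in univ.pi fun _ : Fin n => B, volume (⋃ i, (· + b i) '' A) ≠ ∞ := by
  have h1 : ∫⁻ b in univ.pi fun _ : Fin n => B, volume (⋃ i, (· + b i) '' A) ≤
      ∫⁻ b in univ.pi fun _ : Fin n => B, n * volume A := by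
    refine lintegral_mono fun b => (measure_iUnion_le _).trans ?_
    simp [tsum_fintype]
  rw [setLIntegral_const, volume_pi_pi] at h1
  refine ENNReal.mul_ne_top (ENNReal.inv_ne_top.2 ?_) (ne_top_of_le_ne_top ?_ h1)
  · simp [hB0]
  · simp only [Finset.prod_const]
    exact ENNReal.mul_ne_top (ENNReal.mul_ne_top (ENNReal.natCast_ne_top n) hAt)
      (ENNReal.pow_ne_top hBt)

end expectation

theorem ofReal_integral_le_lintegral_ofReal {α : Type*} [MeasurableSpace α] {μ : Measure α}
    {f : α → ℝ} (hf : Integrable f μ) :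
    ENNReal.ofReal (∫ x, f x ∂μ) ≤ ∫⁻ x, ENNReal.ofReal (f x) ∂μ := by
  have h1 : ∫ x, f x ∂μ ≤ ∫ x, max (f x) 0 ∂μ :=
    integral_mono hf hf.pos_part fun x => le_max_left _ _
  refine (ENNReal.ofReal_le_ofReal h1).trans ?_
  rw [ofReal_integral_eq_lintegral_ofReal hf.pos_part (ae_of_all _ fun x => le_max_right _ _)]
  refine lintegral_mono fun x => ?_
  rw [ENNReal.ofReal_max]
  simp

theorem hasDerivAt_one_sub_pow (m : ℕ) (s : ℝ) :
    HasDerivAt (fun s : ℝ => (1 - s) ^ (m + 1)) (-((m + 1) * (1 - s) ^ m)) s := by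
  refine (((hasDerivAt_id s).const_sub 1).pow (m + 1)).congr_deriv ?_
  simp

theorem hasDerivAt_mul_one_sub_pow (k : ℕ) (s : ℝ) :
    HasDerivAt (fun s : ℝ => -((k + 2) * s * (1 - s) ^ (k + 1)) - (1 - s) ^ (k + 2))
      ((k + 2) * (k + 1) * (1 - s) ^ k * s) s := by
  have h1 := hasDerivAt_one_sub_pow k s
  have h2 := hasDerivAt_one_sub_pow (k + 1) s
  refine (((((hasDerivAt_id s).const_mul (k + 2 : ℝ)).mul h1).neg).sub h2).congr_deriv ?_
  simp only [id]
  push_cast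
  ring

theorem integral_mul_min_eq (k : ℕ) {y : ℝ} (hy0 : 0 ≤ y) (hy1 : y ≤ 1) :
    ∫ s in (0 : ℝ)..1, (k + 2) * (k + 1) * (1 - s) ^ k * min y s = 1 - (1 - y) ^ (k + 2) := by
  have hc : Continuous fun s : ℝ => (k + 2) * (k + 1) * (1 - s) ^ k * min y s := by fun_prop
  rw [← intervalIntegral.integral_add_adjacent_intervals (b := y) (hc.intervalIntegrable _ _)
    (hc.intervalIntegrable _ _)]
  have h1 : ∫ s in (0 : ℝ)..y, (k + 2) * (k + 1) * (1 - s) ^ k * min y s =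
      ∫ s in (0 : ℝ)..y, (k + 2) * (k + 1) * (1 - s) ^ k * s := by
    refine intervalIntegral.integral_congr fun s hs => ?_
    rw [uIcc_of_le hy0] at hs
    simp only [min_eq_right hs.2]
  have h2 : ∫ s in y..1, (k + 2) * (k + 1) * (1 - s) ^ k * min y s =
      ∫ s in y..1, (k + 2) * (k + 1) * (1 - s) ^ k * y := by
    refine intervalIntegral.integral_congr fun s hs => ?_
    rw [uIcc_of_le hy1] at hs
    simp only [min_eq_left hs.1]
  have hd : ∀ s : ℝ, HasDerivAt (fun s : ℝ => -(k + 2) * y * (1 - s) ^ (k + 1))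
      ((k + 2) * (k + 1) * (1 - s) ^ k * y) s := fun s =>
    ((hasDerivAt_one_sub_pow k s).const_mul (-(k + 2) * y)).congr_deriv (by ring)
  rw [h1, h2, intervalIntegral.integral_eq_sub_of_hasDerivAt
      (fun s _ => hasDerivAt_mul_one_sub_pow k s)
      (Continuous.intervalIntegrable (by fun_prop) _ _),
    intervalIntegral.integral_eq_sub_of_hasDerivAt (fun s _ => hd s)
      (Continuous.intervalIntegrable (by fun_prop) _ _)]
  simp
  ring

theorem ofReal_one_sub_pow_eq_lintegral (k : ℕ) {y : ℝ≥0∞} (hy : y ≤ 1) :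
    ∫⁻ s in Ioc (0 : ℝ) 1, ENNReal.ofReal ((k + 2) * (k + 1) * (1 - s) ^ k) *
      min y (ENNReal.ofReal s) = 1 - (1 - y) ^ (k + 2) := by
  lift y to NNReal using ne_top_of_le_ne_top ENNReal.one_ne_top hy
  have hy1 : (y : ℝ) ≤ 1 := by exact_mod_cast hy
  have hc : Continuous fun s : ℝ => (k + 2) * (k + 1) * (1 - s) ^ k * min (y : ℝ) s := by fun_prop
  have h1 : ∫⁻ s in Ioc (0 : ℝ) 1, ENNReal.ofReal ((k + 2) * (k + 1) * (1 - s) ^ k) *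
      min (y : ℝ≥0∞) (ENNReal.ofReal s) =
      ∫⁻ s in Ioc (0 : ℝ) 1, ENNReal.ofReal ((k + 2) * (k + 1) * (1 - s) ^ k * min (y : ℝ) s) := by
    refine setLIntegral_congr_fun measurableSet_Ioc fun s hs => ?_
    have : (0 : ℝ) ≤ 1 - s := sub_nonneg.2 hs.2
    rw [ENNReal.ofReal_mul (q := min (y : ℝ) s) (by positivity), ENNReal.ofReal_min,
      ENNReal.ofReal_coe_nnreal]
  rw [h1, ← ofReal_integral_eq_lintegral_ofReal (hc.integrableOn_Ioc),
    ← intervalIntegral.integral_of_le zero_le_one, integral_mul_min_eq k y.coe_nonneg hy1,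
    ENNReal.ofReal_sub _ (pow_nonneg (sub_nonneg.2 hy1) _), ENNReal.ofReal_one,
    ENNReal.ofReal_pow (sub_nonneg.2 hy1), ENNReal.ofReal_sub _ y.coe_nonneg, ENNReal.ofReal_one,
    ENNReal.ofReal_coe_nnreal]
  refine (ae_restrict_mem measurableSet_Ioc).mono fun s hs => ?_
  have h2 : (0 : ℝ) ≤ 1 - s := sub_nonneg.2 hs.2
  have h3 : 0 ≤ min (y : ℝ) s := le_min y.coe_nonneg hs.1.le
  positivity

theorem integral_mul_one_sub (k : ℕ) (D : ℝ) :
    ∫ s in (0 : ℝ)..1, (k + 2) * (k + 1) * (1 - s) ^ k * s * (1 - D * (1 + (k + 2) * s)) =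
      1 - D * (1 + (k + 2) * (2 / (k + 3))) := by
  have hd : ∀ s : ℝ, HasDerivAt (fun s : ℝ =>
      (1 - D) * (-((k + 2) * s * (1 - s) ^ (k + 1)) - (1 - s) ^ (k + 2)) +
      D * (k + 2) * ((k + 2) * s ^ 2 * (1 - s) ^ (k + 1) + 2 * s * (1 - s) ^ (k + 2) +
        2 / (k + 3) * (1 - s) ^ (k + 3)))
      ((k + 2) * (k + 1) * (1 - s) ^ k * s * (1 - D * (1 + (k + 2) * s))) s := by
    intro s
    have h1 := hasDerivAt_one_sub_pow k s
    have h2 := hasDerivAt_one_sub_pow (k + 1) s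
    have h3 := hasDerivAt_one_sub_pow (k + 2) s
    refine (((hasDerivAt_mul_one_sub_pow k s).const_mul (1 - D)).add
      (((((((hasDerivAt_id s).pow 2).const_mul (k + 2 : ℝ)).mul h1).add
        (((hasDerivAt_id s).const_mul 2).mul h2)).add (h3.const_mul (2 / (k + 3 : ℝ)))).const_mul
          (D * (k + 2)))).congr_deriv ?_
    simp only [Pi.pow_apply, id]
    push_cast
    field_simp
    ring
  rw [intervalIntegral.integral_eq_sub_of_hasDerivAt (fun s _ => hd s)
    (Continuous.intervalIntegrable (by fun_prop) _ _)]
  simp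
  ring

theorem rpow_le_rpow_neg_mul_one_add {s N q : ℝ} (hs : 0 ≤ s) (hN : 0 < N) (hq0 : 0 ≤ q)
    (hq1 : q ≤ 1) : s ^ q ≤ N ^ (-q) * (1 + N * s) := by
  have h1 : s ^ q = N ^ (-q) * (N * s) ^ q := by
    rw [Real.mul_rpow hN.le hs, ← mul_assoc, ← Real.rpow_add hN]
    simp
  have h0 : 0 ≤ N * s := by positivity
  rw [h1]
  gcongr
  rcases le_total (N * s) 1 with h | h
  · exact (Real.rpow_le_one h0 h hq0).trans (by linarith)
  · calc (N * s) ^ q ≤ (N * s) ^ (1 : ℝ) := Real.rpow_le_rpow_of_exponent_le h hq1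
      _ ≤ 1 + N * s := by rw [Real.rpow_one]; linarith

theorem lintegral_one_sub_pow_eq {α : Type*} [MeasurableSpace α] {μ : Measure α} [SFinite μ] (k : ℕ)
    {p : α → ℝ≥0∞} (hp : Measurable p) (hp1 : ∀ x, p x ≤ 1) :
    ∫⁻ x, (1 - (1 - p x) ^ (k + 2)) ∂μ =
      ∫⁻ s in Ioc (0 : ℝ) 1, ENNReal.ofReal ((k + 2) * (k + 1) * (1 - s) ^ k) *
        ∫⁻ x, min (p x) (ENNReal.ofReal s) ∂μ := by
  calc ∫⁻ x, (1 - (1 - p x) ^ (k + 2)) ∂μ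
      = ∫⁻ x, (∫⁻ s in Ioc (0 : ℝ) 1, ENNReal.ofReal ((k + 2) * (k + 1) * (1 - s) ^ k) *
          min (p x) (ENNReal.ofReal s)) ∂μ :=
        lintegral_congr fun x => (ofReal_one_sub_pow_eq_lintegral k (hp1 x)).symm
    _ = ∫⁻ s in Ioc (0 : ℝ) 1, (∫⁻ x, ENNReal.ofReal ((k + 2) * (k + 1) * (1 - s) ^ k) *
          min (p x) (ENNReal.ofReal s) ∂μ) := by
        refine lintegral_lintegral_swap (Measurable.aemeasurable ?_)
        refine Measurable.mul ?_ ?_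
        · exact (Continuous.measurable (by fun_prop : Continuous fun s : ℝ =>
            ((k : ℝ) + 2) * (k + 1) * (1 - s) ^ k)).ennreal_ofReal.comp measurable_snd
        · exact (hp.comp measurable_fst).min measurable_snd.ennreal_ofReal
    _ = _ := lintegral_congr fun s =>
        lintegral_const_mul' _ _ ENNReal.ofReal_ne_top

theorem exists_le_lintegral_one_sub_pow (n : ℕ) {τ : ℝ} (hτ : 0 < τ) :
    ∃ C : ℝ, 0 < C ∧ ∀ (k : ℕ) (b : ℝ) (A B : Set (EuclideanSpace ℝ (Fin (n + 1)))), 0 < b →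
      MeasurableSet A → MeasurableSet B →
      volume A = volume (Metric.ball (0 : EuclideanSpace ℝ (Fin (n + 1))) (τ * b)) →
      volume B = volume (Metric.ball (0 : EuclideanSpace ℝ (Fin (n + 1))) b) →
      ENNReal.ofReal (1 - C * ((k : ℝ) + 2) ^ (-(2 / (n + 2) : ℝ))) *
        volume (Metric.ball (0 : EuclideanSpace ℝ (Fin (n + 1))) (τ * b + b)) ≤
      ∫⁻ x, (1 - (1 - overlap A B x / volume B) ^ (k + 2)) := by
  obtain ⟨C, hC, hCP⟩ := exists_le_lintegral_min_overlap_ball n hτ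
  refine ⟨3 * C, by positivity, fun k b A B hb hA hB hAa hBb => ?_⟩
  set S := volume (Metric.ball (0 : EuclideanSpace ℝ (Fin (n + 1))) (τ * b + b)) with hS
  set q : ℝ := 2 / (n + 2) with hq
  set D : ℝ := C * ((k : ℝ) + 2) ^ (-q) with hD
  have hD0 : 0 ≤ D := by positivity
  have hB0 : volume B ≠ 0 := hBb ▸ (Metric.measure_ball_pos _ _ hb).ne'
  have hBt : volume B ≠ ∞ := hBb ▸ measure_ball_lt_top.ne
  rw [lintegral_one_sub_pow_eq k ((measurable_overlap hA hB).div_const _) fun x =>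
    ENNReal.div_le_of_le_mul (by rw [one_mul]; exact overlap_le _ _ _)]
  have hq0 : 0 ≤ q := by positivity
  have hq1 : q ≤ 1 := by rw [hq, div_le_one (by positivity)]; linarith [Nat.cast_nonneg (α := ℝ) n]
  have hinner : ∀ s : ℝ, s ∈ Ioc (0 : ℝ) 1 →
      ENNReal.ofReal s * (ENNReal.ofReal (1 - D * (1 + (k + 2) * s)) * S) ≤
        ∫⁻ x, min (overlap A B x / volume B) (ENNReal.ofReal s) := by
    intro s hs
    set u : ℝ := s ^ ((1 : ℝ) / (n + 2)) with hu
    have hu0 : 0 < u := Real.rpow_pos_of_pos hs.1 _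
    have hun : u ^ (n + 2) = s := by
      rw [hu, ← Real.rpow_natCast, ← Real.rpow_mul hs.1.le]
      push_cast
      rw [one_div_mul_cancel (by positivity), Real.rpow_one]
    have hu2 : u ^ 2 = s ^ q := by
      rw [hu, ← Real.rpow_natCast, ← Real.rpow_mul hs.1.le, hq]
      congr 1
      push_cast
      ring
    have h1 := hCP b u hb hu0
    rw [hun, hu2, ← hBb] at h1
    have hσ0 : ENNReal.ofReal s * volume B ≠ 0 :=
      mul_ne_zero (ENNReal.ofReal_pos.2 hs.1).ne' hB0
    have h2 := h1.trans (lintegral_min_overlap_ball_le (mul_pos hτ hb).le hb.le hA hB hAa hBb hσ0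
      (ENNReal.mul_ne_top ENNReal.ofReal_ne_top hBt))
    have h3 : ∫⁻ x, min (overlap A B x / volume B) (ENNReal.ofReal s) =
        (∫⁻ x, min (overlap A B x) (ENNReal.ofReal s * volume B)) * (volume B)⁻¹ := by
      rw [← lintegral_mul_const' _ _ (ENNReal.inv_ne_top.2 hB0)]
      refine lintegral_congr fun x => ?_
      rw [min_mul_of_nonneg _ _ zero_le, mul_assoc, ENNReal.mul_inv_cancel hB0 hBt, mul_one,
        div_eq_mul_inv]
    rw [h3]
    calc ENNReal.ofReal s * (ENNReal.ofReal (1 - D * (1 + (k + 2) * s)) * S)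
        ≤ ENNReal.ofReal s * (ENNReal.ofReal (1 - C * s ^ q) * S) := by
          have h4 : C * s ^ q ≤ D * (1 + (k + 2) * s) := by
            have := rpow_le_rpow_neg_mul_one_add hs.1.le (by positivity : (0 : ℝ) < k + 2) hq0 hq1
            rw [hD, mul_assoc]
            gcongr
          exact mul_le_mul' le_rfl (mul_le_mul' (ENNReal.ofReal_le_ofReal (by linarith)) le_rfl)
      _ = ENNReal.ofReal s * volume B * (ENNReal.ofReal (1 - C * s ^ q) * S) * (volume B)⁻¹ := by
          rw [mul_right_comm _ (volume B), mul_assoc _ (volume B), ENNReal.mul_inv_cancel hB0 hBt,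
            mul_one]
      _ ≤ _ := by gcongr
  have hc : Continuous fun s : ℝ =>
      (k + 2) * (k + 1) * (1 - s) ^ k * s * (1 - D * (1 + (k + 2) * s)) := by fun_prop
  calc ENNReal.ofReal (1 - 3 * C * ((k : ℝ) + 2) ^ (-q)) * S
      ≤ ENNReal.ofReal (∫ s in Ioc (0 : ℝ) 1,
          (k + 2) * (k + 1) * (1 - s) ^ k * s * (1 - D * (1 + (k + 2) * s))) * S := by
        rw [← intervalIntegral.integral_of_le zero_le_one, integral_mul_one_sub]
        have h1 : ((k : ℝ) + 2) * (2 / (k + 3)) ≤ 2 := by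
          rw [mul_div_assoc', div_le_iff₀ (by positivity)]
          linarith
        rw [mul_assoc, ← hD]
        exact mul_le_mul' (ENNReal.ofReal_le_ofReal (by nlinarith)) le_rfl
    _ ≤ (∫⁻ s in Ioc (0 : ℝ) 1, ENNReal.ofReal
          ((k + 2) * (k + 1) * (1 - s) ^ k * s * (1 - D * (1 + (k + 2) * s)))) * S := by
        gcongr
        exact ofReal_integral_le_lintegral_ofReal hc.integrableOn_Ioc
    _ = ∫⁻ s in Ioc (0 : ℝ) 1, ENNReal.ofReal
          ((k + 2) * (k + 1) * (1 - s) ^ k * s * (1 - D * (1 + (k + 2) * s))) * S :=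
        (lintegral_mul_const' _ _ measure_ball_lt_top.ne).symm
    _ ≤ _ := by
        refine setLIntegral_mono' measurableSet_Ioc fun s hs => ?_
        have h0 : (0 : ℝ) ≤ 1 - s := sub_nonneg.2 hs.2
        have h1 := hs.1.le
        rw [ENNReal.ofReal_mul (by positivity), ENNReal.ofReal_mul (by positivity),
          mul_assoc, mul_assoc]
        gcongr
        exact hinner s hs

theorem volume_ball_rpow_add (n : ℕ) {a b : ℝ} (ha : 0 ≤ a) (hb : 0 ≤ b) :
    (volume (Metric.ball (0 : EuclideanSpace ℝ (Fin (n + 1))) (a + b))).toReal =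
      ((volume (Metric.ball (0 : EuclideanSpace ℝ (Fin (n + 1))) a)).toReal ^
          ((1 : ℝ) / (n + 1 : ℕ)) +
        (volume (Metric.ball (0 : EuclideanSpace ℝ (Fin (n + 1))) b)).toReal ^
          ((1 : ℝ) / (n + 1 : ℕ))) ^ (n + 1) := by
  set ω := (volume (Metric.ball (0 : EuclideanSpace ℝ (Fin (n + 1))) 1)).toReal with hω
  have h1 : ∀ r : ℝ, 0 ≤ r → (volume (Metric.ball (0 : EuclideanSpace ℝ (Fin (n + 1))) r)).toReal =
      r ^ (n + 1) * ω := fun r hr => by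
    rw [Measure.addHaar_ball _ _ hr, ENNReal.toReal_mul, ENNReal.toReal_ofReal (by positivity)]
    simp [hω]
  have h2 : ∀ r : ℝ, 0 ≤ r → (r ^ (n + 1) * ω) ^ ((1 : ℝ) / (n + 1 : ℕ)) =
      r * ω ^ ((1 : ℝ) / (n + 1 : ℕ)) := fun r hr => by
    rw [Real.mul_rpow (by positivity) ENNReal.toReal_nonneg, one_div,
      Real.pow_rpow_inv_natCast hr (by omega)]
  rw [h1 _ (add_nonneg ha hb), h1 _ ha, h1 _ hb, h2 _ ha, h2 _ hb, ← add_mul, mul_pow, one_div,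
    Real.rpow_inv_natCast_pow ENNReal.toReal_nonneg (by omega)]

end Helpers

theorem stmt1 (d : ℕ) (hd : 1 ≤ d) (t : ℝ) (ht : 0 < t) :
    ∃ c : ℝ, 0 < c ∧ ∀ ε : ℝ, 0 < ε → ∃ N : ℕ, ∀ n : ℕ, N ≤ n →
      ∀ A B : Set (EuclideanSpace ℝ (Fin d)), MeasurableSet A → MeasurableSet B →
        0 < volume A → volume A < ⊤ → 0 < volume B → volume B < ⊤ →
        (volume A).toReal = t * (volume B).toReal →
        expUnion (fun _ : Fin n => A) (fun _ => B) ≥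
          ((volume A).toReal ^ ((1 : ℝ) / d) + (volume B).toReal ^ ((1 : ℝ) / d)) ^ d *
            (1 - (c + ε) * (n : ℝ) ^ (-(2 : ℝ) / (d + 1))) := by
  obtain ⟨m, rfl⟩ : ∃ m, d = m + 1 := ⟨d - 1, by omega⟩
  set τ : ℝ := t ^ ((1 : ℝ) / (m + 1 : ℕ)) with hτdef
  have hτ : 0 < τ := Real.rpow_pos_of_pos ht _
  have hτt : τ ^ (m + 1) = t := by
    rw [hτdef, one_div, Real.rpow_inv_natCast_pow ht.le (by omega)]
  obtain ⟨C, hC, hCP⟩ := exists_le_lintegral_one_sub_pow m hτ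
  refine ⟨C, hC, fun ε hε => ⟨2, fun n hn A B hA hB hA0 hAt hB0 hBt hAB => ?_⟩⟩
  obtain ⟨k, rfl⟩ : ∃ k, n = k + 2 := ⟨n - 2, by omega⟩
  obtain ⟨b, hb, hBb⟩ := exists_volume_ball_eq (E := EuclideanSpace ℝ (Fin (m + 1))) hBt.ne
  have hb0 : 0 < b := by
    refine lt_of_le_of_ne hb fun h => hB0.ne' ?_
    rw [← hBb, ← h, Metric.ball_zero, measure_empty]
  have hAa : volume A = volume (Metric.ball (0 : EuclideanSpace ℝ (Fin (m + 1))) (τ * b)) := by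
    rw [Measure.addHaar_ball_mul _ _ hτ.le, hBb, ← ENNReal.ofReal_toReal hAt.ne, hAB,
      ENNReal.ofReal_mul ht.le, ENNReal.ofReal_toReal hBt.ne]
    simp [hτt]
  have hS := volume_ball_rpow_add m (mul_pos hτ hb0).le hb
  rw [← hAa, hBb] at hS
  have h1 := hCP k b A B hb0 hA hB hAa hBb.symm
  rw [← expectation_volume_iUnion_translate (n := k + 2) hA hB hB0.ne' hBt.ne] at h1
  have h2 := ENNReal.toReal_mono
    (expectation_volume_iUnion_translate_ne_top hAt.ne hB0.ne' hBt.ne) h1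
  rw [ENNReal.toReal_mul, hS] at h2
  refine ge_iff_le.2 (le_trans ?_ h2)
  rw [mul_comm]
  gcongr
  refine le_trans ?_ (le_max_left _ 0)
  have h3 : (-(2 : ℝ) / ((m + 1 : ℕ) + 1)) = -(2 / (m + 2) : ℝ) := by
    push_cast
    rw [neg_div, add_assoc]
    norm_num
  rw [h3]
  push_cast
  gcongr
  linarith
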